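/- arXiv:2105.05315 — 2 statements merged into one kernel-verified Lean document; each statement's English description precedes it below -/
import Mathlib

section
/- Every strongly first order generalized dependency is first order; that is, if D is a generalized dependency such that every sentence of FO(D) is equivalent to some first-order sentence, then there exists a first-order sentence D(R) over the signature {R} such that D = {(M,R) : (M,R) ⊨ D(R)}. -/
namespace DSFO

/-- A purely relational signature: for each arity, a type of relation symbols. -/
abbrev Signature := ℕ → Type

/-- The empty signature. -/
def Sig0 : Signature := fun _ => Empty

/-- The signature with a single `k`-ary relation symbol `R`. -/
def SigR (k : ℕ) : Signature := fun n => PLift (n = k)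

/-- Syntax of team-semantics formulas (in negation normal form, with the two
additional connectives: global disjunction `gdisj` and contradictory negation
`cneg`) over a relational signature `S`, with generalized dependency atoms
indexed by `ι` with arities `ar`.  Variables are natural numbers. -/
inductive TS (S : Signature) (ι : Type) (ar : ι → ℕ) : Type
  | rel {k : ℕ} (r : S k) (v : Fin k → ℕ)
  | nrel {k : ℕ} (r : S k) (v : Fin k → ℕ)
  | eq (x y : ℕ)
  | neq (x y : ℕ)
  | dep (i : ι) (v : Fin (ar i) → ℕ)
  | and (φ ψ : TS S ι ar)
  | or (φ ψ : TS S ι ar)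
  | gdisj (φ ψ : TS S ι ar)
  | cneg (φ : TS S ι ar)
  | ex (v : ℕ) (φ : TS S ι ar)
  | al (v : ℕ) (φ : TS S ι ar)

/-- The always-true literal `⊤`. -/
def TS.top {S : Signature} {ι : Type} {ar : ι → ℕ} : TS S ι ar := .eq 0 0

/-- The arity function for "no dependency atoms". -/
def noAtoms : Empty → ℕ := fun e => e.elim

/-- First-order formulas over `S` (no dependency atoms; here `cneg` plays the
role of ordinary classical negation and `gdisj` of ordinary disjunction, so
this is full first-order logic). -/
abbrev FOF (S : Signature) := TS S Empty noAtoms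

/-- First-order formulas over the empty signature. -/
abbrev EF := FOF Sig0

/-- Free variables of a formula. -/
def fv {S : Signature} {ι : Type} {ar : ι → ℕ} : TS S ι ar → Set ℕ
  | .rel _ v => Set.range v
  | .nrel _ v => Set.range v
  | .eq x y => {x, y}
  | .neq x y => {x, y}
  | .dep _ v => Set.range v
  | .and φ ψ => fv φ ∪ fv ψ
  | .or φ ψ => fv φ ∪ fv ψ
  | .gdisj φ ψ => fv φ ∪ fv ψ
  | .cneg φ => fv φ
  | .ex v φ => fv φ \ {v}
  | .al v φ => fv φ \ {v}

/-- A sentence is a formula with no free variables. -/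
def IsSentence {S : Signature} {ι : Type} {ar : ι → ℕ} (φ : TS S ι ar) : Prop :=
  fv φ = ∅

/-- No global disjunctions occur. -/
def NoGdisj {S : Signature} {ι : Type} {ar : ι → ℕ} : TS S ι ar → Prop
  | .rel _ _ => True
  | .nrel _ _ => True
  | .eq _ _ => True
  | .neq _ _ => True
  | .dep _ _ => True
  | .and φ ψ => NoGdisj φ ∧ NoGdisj ψ
  | .or φ ψ => NoGdisj φ ∧ NoGdisj ψ
  | .gdisj _ _ => False
  | .cneg φ => NoGdisj φ
  | .ex _ φ => NoGdisj φ
  | .al _ φ => NoGdisj φ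

/-- No contradictory negations occur. -/
def NoCneg {S : Signature} {ι : Type} {ar : ι → ℕ} : TS S ι ar → Prop
  | .rel _ _ => True
  | .nrel _ _ => True
  | .eq _ _ => True
  | .neq _ _ => True
  | .dep _ _ => True
  | .and φ ψ => NoCneg φ ∧ NoCneg ψ
  | .or φ ψ => NoCneg φ ∧ NoCneg ψ
  | .gdisj φ ψ => NoCneg φ ∧ NoCneg ψ
  | .cneg _ => False
  | .ex _ φ => NoCneg φ
  | .al _ φ => NoCneg φ

/-- Formulas of `FO(𝒟)` proper: no `gdisj` and no `cneg`. -/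
def Plain {S : Signature} {ι : Type} {ar : ι → ℕ} (φ : TS S ι ar) : Prop :=
  NoCneg φ ∧ NoGdisj φ

/-- Atomic formulas: first-order literals and dependency atoms. -/
def Atomic {S : Signature} {ι : Type} {ar : ι → ℕ} : TS S ι ar → Prop
  | .rel _ _ => True
  | .nrel _ _ => True
  | .eq _ _ => True
  | .neq _ _ => True
  | .dep _ _ => True
  | _ => False

/-- Formulas of `FO(∼₀, 𝒟)`: the contradictory negation may appear only in
front of first-order literals and dependency atoms (and there is no `gdisj`). -/
def Cneg0 {S : Signature} {ι : Type} {ar : ι → ℕ} : TS S ι ar → Prop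
  | .rel _ _ => True
  | .nrel _ _ => True
  | .eq _ _ => True
  | .neq _ _ => True
  | .dep _ _ => True
  | .and φ ψ => Cneg0 φ ∧ Cneg0 ψ
  | .or φ ψ => Cneg0 φ ∧ Cneg0 ψ
  | .gdisj _ _ => False
  | .cneg φ => Atomic φ
  | .ex _ φ => Cneg0 φ
  | .al _ φ => Cneg0 φ

/-- The negation normal form of the (dual) negation of a formula. -/
def TS.nneg {S : Signature} {ι : Type} {ar : ι → ℕ} : TS S ι ar → TS S ι ar
  | .rel r v => .nrel r v
  | .nrel r v => .rel r v
  | .eq x y => .neq x y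
  | .neq x y => .eq x y
  | .dep i v => .cneg (.dep i v)
  | .and φ ψ => .or (TS.nneg φ) (TS.nneg ψ)
  | .or φ ψ => .and (TS.nneg φ) (TS.nneg ψ)
  | .gdisj φ ψ => .and (TS.nneg φ) (TS.nneg ψ)
  | .cneg φ => φ
  | .ex v φ => .al v (TS.nneg φ)
  | .al v φ => .ex v (TS.nneg φ)

/-- Iterated existential quantification over a list of variables. -/
def exs {S : Signature} {ι : Type} {ar : ι → ℕ} (l : List ℕ) (φ : TS S ι ar) :
    TS S ι ar := l.foldr TS.ex φ

/-- An interpretation of a relational signature in a domain `M`. -/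
abbrev Interp (S : Signature) (M : Type) := ∀ k, S k → Set (Fin k → M)

/-- The unique interpretation of the empty signature. -/
def eI (M : Type) : Interp Sig0 M := fun _ e => e.elim

/-- The interpretation of `SigR k` given by a `k`-ary relation `R`. -/
def interpR {k : ℕ} {M : Type} (R : Set (Fin k → M)) : Interp (SigR k) M :=
  fun _ r => {s | (fun i => s (Fin.cast r.down.symm i)) ∈ R}

/-- Tarskian (single-assignment) satisfaction.  Dependency atoms are
(vacuously) interpreted as true; this is only used on first-order formulas. -/
def FSat {S : Signature} {ι : Type} {ar : ι → ℕ} (M : Type) (I : Interp S M) :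
    (ℕ → M) → TS S ι ar → Prop
  | s, .rel r v => (fun i => s (v i)) ∈ I _ r
  | s, .nrel r v => (fun i => s (v i)) ∉ I _ r
  | s, .eq x y => s x = s y
  | s, .neq x y => s x ≠ s y
  | _, .dep _ _ => True
  | s, .and φ ψ => FSat M I s φ ∧ FSat M I s ψ
  | s, .or φ ψ => FSat M I s φ ∨ FSat M I s ψ
  | s, .gdisj φ ψ => FSat M I s φ ∨ FSat M I s ψ
  | s, .cneg φ => ¬ FSat M I s φ
  | s, .ex v φ => ∃ m : M, FSat M I (Function.update s v m) φ
  | s, .al v φ => ∀ m : M, FSat M I (Function.update s v m) φ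

/-- Truth of a first-order sentence (Tarskian semantics). -/
def FOTrue {S : Signature} {ι : Type} {ar : ι → ℕ} (M : Type) (I : Interp S M)
    (φ : TS S ι ar) : Prop :=
  ∀ s : ℕ → M, FSat M I s φ

/-- The relation `X(x̄)` determined by a team `X` and a tuple of variables `x̄`. -/
def teamProj {M : Type} {k : ℕ} (v : Fin k → ℕ) (X : Set (ℕ → M)) :
    Set (Fin k → M) := {t | ∃ s ∈ X, t = fun j => s (v j)}

/-- (Lax) team semantics.  `A` gives the semantics of each dependency atom as a
function of the relation `X(x̄)`. -/
def TSat {S : Signature} {ι : Type} {ar : ι → ℕ} (M : Type) (I : Interp S M)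
    (A : ∀ i, Set (Fin (ar i) → M) → Prop) :
    TS S ι ar → Set (ℕ → M) → Prop
  | .rel r v, X => ∀ s ∈ X, (fun i => s (v i)) ∈ I _ r
  | .nrel r v, X => ∀ s ∈ X, (fun i => s (v i)) ∉ I _ r
  | .eq x y, X => ∀ s ∈ X, s x = s y
  | .neq x y, X => ∀ s ∈ X, s x ≠ s y
  | .dep i v, X => A i (teamProj v X)
  | .and φ ψ, X => TSat M I A φ X ∧ TSat M I A ψ X
  | .or φ ψ, X => ∃ Y Z : Set (ℕ → M), Y ∪ Z = X ∧ TSat M I A φ Y ∧ TSat M I A ψ Z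
  | .gdisj φ ψ, X => TSat M I A φ X ∨ TSat M I A ψ X
  | .cneg φ, X => ¬ TSat M I A φ X
  | .ex v φ, X => ∃ H : (ℕ → M) → Set M, (∀ s ∈ X, (H s).Nonempty) ∧
      TSat M I A φ {s' | ∃ s ∈ X, ∃ m ∈ H s, s' = Function.update s v m}
  | .al v φ, X => TSat M I A φ {s' | ∃ s ∈ X, ∃ m : M, s' = Function.update s v m}

/-- Truth of a sentence under team semantics: satisfaction by the team of all
assignments (by locality, equivalent to satisfaction by `{∅}`). -/
def TTrue {S : Signature} {ι : Type} {ar : ι → ℕ} (M : Type) (I : Interp S M)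
    (A : ∀ i, Set (Fin (ar i) → M) → Prop) (φ : TS S ι ar) : Prop :=
  TSat M I A φ Set.univ

/-- A `k`-ary dependency predicate: a class of pairs `(M, R)`. -/
abbrev DepPred (k : ℕ) := ∀ M : Type, Set (Fin k → M) → Prop

/-- Closure under isomorphisms (part of the definition of a generalized
dependency). -/
def IsoClosed {k : ℕ} (D : DepPred k) : Prop :=
  ∀ (M N : Type) (e : M ≃ N) (R : Set (Fin k → M)),
    D M R → D N ((fun f => e ∘ f) '' R)

/-- The complement `∼D` of a dependency. -/
def complD {k : ℕ} (D : DepPred k) : DepPred k := fun M R => ¬ D M R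

def DownwardsClosed {k : ℕ} (D : DepPred k) : Prop :=
  ∀ (M : Type) (R R' : Set (Fin k → M)), D M R → R' ⊆ R → D M R'

/-- The downwards closure `D↓`. -/
def dClosure {k : ℕ} (D : DepPred k) : DepPred k :=
  fun M R => ∃ R', R ⊆ R' ∧ D M R'

/-- `D_max`: the maximal models of `D`. -/
def DMax {k : ℕ} (D : DepPred k) : DepPred k :=
  fun M R => D M R ∧ ∀ R', R ⊂ R' → ¬ D M R'

/-- The empty team property. -/
def EmptyTeamProp {k : ℕ} (D : DepPred k) : Prop :=
  ∀ M : Type, Nontrivial M → D M (∅ : Set (Fin k → M))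

/-- `D` is a first-order dependency: it is the class of models of a first-order
sentence over the signature `{R}`. -/
def FirstOrderDep {k : ℕ} (D : DepPred k) : Prop :=
  ∃ ψ : FOF (SigR k), IsSentence ψ ∧
    ∀ (M : Type), Nontrivial M → ∀ R : Set (Fin k → M),
      (D M R ↔ FOTrue M (interpR R) ψ)

/-- The interpretation of a unary predicate symbol as a subset of the domain. -/
def PSet {S : Signature} {M : Type} (I : Interp S M) (P : S 1) : Set M :=
  {m | (fun _ => m) ∈ I 1 P}

/-- Semantics of the relativization `D^(P)` of `D` to the unary predicate `P`:
`𝔐 ⊨_X D^(P) x̄` iff `(P^𝔐, X(x̄)) ∈ D`. -/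
def relSem {k : ℕ} (D : DepPred k) {S : Signature} (P : S 1)
    (M : Type) (I : Interp S M) (R : Set (Fin k → M)) : Prop :=
  (∀ f ∈ R, ∀ j, f j ∈ PSet I P) ∧
    D (↥(PSet I P)) {g : Fin k → ↥(PSet I P) | (fun j => (g j : M)) ∈ R}

/-- A family `𝒟` of generalized dependencies is strongly first order: every
sentence of `FO(𝒟)` is equivalent to some first-order sentence. -/
def SFOFam {ι : Type} {ar : ι → ℕ} (D : ∀ i, DepPred (ar i)) : Prop :=
  ∀ (S : Signature) (φ : TS S ι ar), IsSentence φ → Plain φ →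
    ∃ ψ : FOF S, IsSentence ψ ∧
      ∀ (M : Type), Nontrivial M → ∀ I : Interp S M,
        (TTrue M I (fun i => D i M) φ ↔ FOTrue M I ψ)

/-- A single dependency is strongly first order iff `{D}` is. -/
def SFOd {k : ℕ} (D : DepPred k) : Prop :=
  SFOFam (ι := Unit) (ar := fun _ => k) (fun _ => D)

/-- A family `𝒟` is relativizable: every sentence of `FO(𝒟^(P))` is equivalent
to some sentence of `FO(𝒟)`. -/
def RelativizableFam {ι : Type} {ar : ι → ℕ} (D : ∀ i, DepPred (ar i)) : Prop :=
  ∀ (S : Signature) (P : S 1) (φ : TS S ι ar), IsSentence φ → Plain φ →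
    ∃ ψ : TS S ι ar, IsSentence ψ ∧ Plain ψ ∧
      ∀ (M : Type), Nontrivial M → ∀ I : Interp S M,
        (TTrue M I (fun i => relSem (D i) P M I) φ ↔ TTrue M I (fun i => D i M) ψ)

def Relativizable1 {k : ℕ} (D : DepPred k) : Prop :=
  RelativizableFam (ι := Unit) (ar := fun _ => k) (fun _ => D)

/-- The family `𝒟 ∪ ∼𝒟`. -/
def withComplFam {ι : Type} {ar : ι → ℕ} (D : ∀ i, DepPred (ar i)) :
    ∀ i : ι ⊕ ι, DepPred (Sum.elim ar ar i) :=
  fun i => match i with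
    | .inl a => D a
    | .inr a => complD (D a)

/-- `D` is doubly strongly first order: `{D, ∼D}` is strongly first order. -/
def DSFOd {k : ℕ} (D : DepPred k) : Prop :=
  SFOFam (ι := Bool) (ar := fun _ => k)
    (fun b => match b with | true => D | false => complD D)

/-- The constancy atom of arity `k`. -/
def constD (k : ℕ) : DepPred k := fun _ R => ∀ f ∈ R, ∀ g ∈ R, f = g

/-- The totality atom of arity `k`. -/
def allD (k : ℕ) : DepPred k := fun M R => R = (Set.univ : Set (Fin k → M))

/-- The family `𝒟 ∪ {const}` (constancy atoms of every arity). -/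
def withConst {ι : Type} {ar : ι → ℕ} (D : ∀ i, DepPred (ar i)) :
    ∀ i : ι ⊕ ℕ, DepPred (Sum.elim ar id i) :=
  fun i => match i with
    | .inl a => D a
    | .inr n => constD n

/-- The atoms of `𝒟^(P) ∪ {const}`. -/
def withConstRel {ι : Type} {ar : ι → ℕ} (D : ∀ i, DepPred (ar i))
    {S : Signature} (P : S 1) (M : Type) (I : Interp S M) :
    ∀ i : ι ⊕ ℕ, Set (Fin (Sum.elim ar id i) → M) → Prop :=
  fun i => match i with
    | .inl a => relSem (D a) P M I
    | .inr n => constD n M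

/-- Atom indices of the logic `FO(𝒟₀, ⊔, const, All)`: the 0-ary first-order
dependencies `[ψ]`, the constancy atoms and the totality atoms. -/
inductive CIdx : Type
  | d0 (ψ : EF) (hψ : IsSentence ψ)
  | const (k : ℕ)
  | total (k : ℕ)

def cAr : CIdx → ℕ
  | .d0 _ _ => 0
  | .const k => k
  | .total k => k

def cSem (M : Type) : ∀ i : CIdx, Set (Fin (cAr i) → M) → Prop
  | .d0 ψ _, _ => FOTrue M (eI M) ψ
  | .const _, R => ∀ f ∈ R, ∀ g ∈ R, f = g
  | .total _, R => R = Set.univ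

/-- Embedding of first-order formulas over the empty signature into any
team logic. -/
def embedEF {S : Signature} {ι : Type} {ar : ι → ℕ} : EF → TS S ι ar
  | .rel r _ => Empty.elim r
  | .nrel r _ => Empty.elim r
  | .eq x y => .eq x y
  | .neq x y => .neq x y
  | .dep i _ => Empty.elim i
  | .and φ ψ => .and (embedEF φ) (embedEF ψ)
  | .or φ ψ => .or (embedEF φ) (embedEF ψ)
  | .gdisj φ ψ => .gdisj (embedEF φ) (embedEF ψ)
  | .cneg φ => .cneg (embedEF φ)
  | .ex v φ => .ex v (embedEF φ)
  | .al v φ => .al v (embedEF φ)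

/-- Override the values of the variables `0, …, k-1` by the tuple `f`. -/
def overrideFin {M : Type} (k : ℕ) (f : Fin k → M) (s : ℕ → M) : ℕ → M :=
  fun v => if h : v < k then f ⟨v, h⟩ else s v

/-- `(M, R) ⊨ ∃ȳ ∀x̄ (R x̄ → θ(x̄, ȳ))`, where `x̄` is the tuple of variables
`0, …, k-1` and the remaining free variables `ȳ` of `θ` are witnessed by `s`. -/
def ExAllSem {k : ℕ} (M : Type) (R : Set (Fin k → M)) (θ : EF) : Prop :=
  ∃ s : ℕ → M, ∀ f ∈ R, FSat M (eI M) (overrideFin k f s) θ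

/-- `(M, R) ⊨ ∃ȳ ∀x̄ (R x̄ ↔ θ(x̄, ȳ))`. -/
def ExAllIffSem {k : ℕ} (M : Type) (R : Set (Fin k → M)) (θ : EF) : Prop :=
  ∃ s : ℕ → M, ∀ f : Fin k → M, (f ∈ R ↔ FSat M (eI M) (overrideFin k f s) θ)

/-- The assignment sending `x̄ = (0, …, k-1)` to `f`, `ȳ = (k, …, k+n-1)` to
`a`, and every other variable to its value under `s0`. -/
def tupAsg {M : Type} (k n : ℕ) (f : Fin k → M) (a : Fin n → M) (s0 : ℕ → M) :
    ℕ → M :=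
  fun v => if h : v < k then f ⟨v, h⟩ else if h2 : v - k < n then a ⟨v - k, h2⟩ else s0 v

/-- `R` is defined by the formula `θ(x̄, ȳ)` (with `x̄ = (0, …, k-1)` and
`ȳ = (k, …, k+n-1)`): there is a tuple `ā` of parameters such that
`R = {m̄ : 𝔐 ⊨ θ(m̄, ā)}`. -/
def DefinedBy {S : Signature} {M : Type} (I : Interp S M) (k n : ℕ)
    (θ : FOF S) (R : Set (Fin k → M)) : Prop :=
  ∃ a : Fin n → M, ∀ s0 : ℕ → M, R = {f | FSat M I (tupAsg k n f a s0) θ}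

/-- `θ(x̄, ȳ)` fixes the identity type of `ȳ = (k, …, k+n-1)`. -/
def FixesIdType {S : Signature} (k n : ℕ) (θ : FOF S) : Prop :=
  ∀ i j : Fin n,
    (∀ (M : Type), Nontrivial M → ∀ (I : Interp S M) (s : ℕ → M),
        FSat M I s θ → s (k + (i : ℕ)) = s (k + (j : ℕ))) ∨
    (∀ (M : Type), Nontrivial M → ∀ (I : Interp S M) (s : ℕ → M),
        FSat M I s θ → s (k + (i : ℕ)) ≠ s (k + (j : ℕ)))

/-- `(M, R := Xv) ⊨ ∃ȳ ∀x̄ (R x̄ → θ(x̄, ȳ))` where the `x̄`-slots of `θ` are the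
variables `v̄` and the `ȳ`-slots are the variables `ȳ`. -/
def projExAll {M : Type} {k n : ℕ} (v : Fin k → ℕ) (y : Fin n → ℕ) (θ : EF)
    (Xv : Set (Fin k → M)) : Prop :=
  ∃ b : Fin n → M, ∀ f ∈ Xv, ∀ s : ℕ → M,
    (∀ j, s (v j) = f j) → (∀ i, s (y i) = b i) → FSat M (eI M) s θ


/-- Iterated universal quantification over a list of variables. -/
def alls {S : Signature} {ι : Type} {ar : ι → ℕ} (l : List ℕ) (φ : TS S ι ar) :
    TS S ι ar := l.foldr TS.al φ

theorem fv_alls {S : Signature} {ι : Type} {ar : ι → ℕ} (l : List ℕ) (φ : TS S ι ar) :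
    fv (alls l φ) = fv φ \ {v | v ∈ l} := by
  induction l with
  | nil => simp [alls]
  | cons a l ih =>
    change fv (alls l φ) \ {a} = _
    rw [ih]
    ext x
    simp only [Set.mem_sdiff, Set.mem_ofPred_eq, Set.mem_singleton_iff, List.mem_cons]
    tauto

theorem plain_alls {S : Signature} {ι : Type} {ar : ι → ℕ} (l : List ℕ) {φ : TS S ι ar}
    (h : Plain φ) : Plain (alls l φ) := by
  induction l with
  | nil => exact h
  | cons a l ih => exact ih

/-- Universal quantifiers do nothing to the team of all assignments. -/
theorem tTrue_alls {S : Signature} {ι : Type} {ar : ι → ℕ} (M : Type) (I : Interp S M)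
    (A : ∀ i, Set (Fin (ar i) → M) → Prop) (l : List ℕ) (φ : TS S ι ar) :
    TTrue M I A (alls l φ) ↔ TTrue M I A φ := by
  induction l with
  | nil => rfl
  | cons a l ih =>
    rw [← ih]
    have hu : {s' : ℕ → M | ∃ s ∈ Set.univ, ∃ m : M, s' = Function.update s a m} =
        Set.univ :=
      Set.eq_univ_of_forall fun s => ⟨s, trivial, s a, (Function.update_eq_self a s).symm⟩
    change TSat M I A (alls l φ) {s' | ∃ s ∈ Set.univ, ∃ m : M, s' = Function.update s a m} ↔
      TSat M I A (alls l φ) Set.univ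
    rw [hu]

/-- The formula `¬R x̄ ∨ (R x̄ ∧ D x̄)`. -/
def guardedDep (k : ℕ) : TS (SigR k) Unit (fun _ => k) :=
  .or (.nrel (k := k) ⟨rfl⟩ (fun i => i))
    (.and (.rel (k := k) ⟨rfl⟩ (fun i => i)) (.dep () (fun i => i)))

theorem fv_guardedDep (k : ℕ) : fv (guardedDep k) ⊆ {v | v ∈ List.range k} := by
  intro x hx
  simp only [guardedDep, fv, Set.union_self, Set.mem_range] at hx
  obtain ⟨i, rfl⟩ := hx
  simp

/-- The only way to split the full team for `guardedDep` is along `R` and its complement. -/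
theorem tTrue_guardedDep {k : ℕ} (D : DepPred k) (M : Type) [Nonempty M]
    (R : Set (Fin k → M)) :
    TTrue M (interpR R) (fun _ : Unit => D M) (guardedDep k) ↔ D M R := by
  have proj : teamProj (fun i : Fin k => (i : ℕ)) {s : ℕ → M | (fun i : Fin k => s i) ∈ R} =
      R := by
    ext f
    constructor
    · rintro ⟨s, hs, rfl⟩
      exact hs
    · intro hf
      obtain ⟨m⟩ := ‹Nonempty M›
      have h : (fun j : Fin k => overrideFin k f (fun _ => m) j) = f := by
        funext j
        simp [overrideFin]
      refine ⟨overrideFin k f fun _ => m, ?_, h.symm⟩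
      change (fun j : Fin k => overrideFin k f (fun _ => m) j) ∈ R
      rwa [h]
  constructor
  · rintro ⟨Y, Z, hYZ, hY, hZ, hD⟩
    have hZR : Z = {s : ℕ → M | (fun i : Fin k => s i) ∈ R} := by
      ext s
      refine ⟨hZ s, fun hs => ?_⟩
      have hmem : s ∈ Y ∪ Z := hYZ ▸ Set.mem_univ s
      exact hmem.resolve_left fun h => hY s h hs
    change D M (teamProj (fun i : Fin k => (i : ℕ)) Z) at hD
    rwa [hZR, proj] at hD
  · intro hD
    refine ⟨{s | (fun i : Fin k => s i) ∉ R}, {s | (fun i : Fin k => s i) ∈ R}, ?_,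
      fun s hs => hs, fun s hs => hs, ?_⟩
    · ext s
      simp [em']
    · change D M (teamProj (fun i : Fin k => (i : ℕ)) _)
      rwa [proj]

/-- Every strongly first order generalized dependency is first
order: if `D` is a generalized dependency such that every sentence of `FO(D)`
is equivalent to some first-order sentence, then there is a first-order
sentence `D(R)` over the signature `{R}` defining `D`. -/
theorem strongly_first_order_is_first_order {k : ℕ} (D : DepPred k)
    (hiso : IsoClosed D) (hsfo : SFOd D) : FirstOrderDep D := by
  obtain ⟨ψ, hψ, h⟩ := hsfo (SigR k) (alls (List.range k) (guardedDep k))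
    ((fv_alls _ _).trans (Set.sdiff_eq_empty.2 (fv_guardedDep k)))
    (plain_alls _ (by simp [Plain, guardedDep, NoCneg, NoGdisj]))
  refine ⟨ψ, hψ, fun M hM R => ?_⟩
  rw [← h M hM, tTrue_alls, tTrue_guardedDep]

end DSFO
end

section
/- Let 𝒟 be a family of downwards closed, relativizable generalized dependencies, each with the empty team property. Then 𝒟 is strongly first order if and only if every dependency D ∈ 𝒟 is strongly first order. -/
namespace DSFO

section FirstOrder

variable {S : Signature} {M : Type}

/-- Satisfaction depends only on the values of the free variables. -/
theorem fsat_congr {ι : Type} {ar : ι → ℕ} (I : Interp S M) (φ : TS S ι ar) {s t : ℕ → M}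
    (h : ∀ v ∈ fv φ, s v = t v) : FSat M I s φ ↔ FSat M I t φ := by
  induction φ generalizing s t with
  | rel r v =>
    have : (fun i => s (v i)) = fun i => t (v i) := funext fun i => h _ ⟨i, rfl⟩
    simp only [FSat, this]
  | nrel r v =>
    have : (fun i => s (v i)) = fun i => t (v i) := funext fun i => h _ ⟨i, rfl⟩
    simp only [FSat, this]
  | eq x y => simp only [FSat, h x (by simp [fv]), h y (by simp [fv])]
  | neq x y => simp only [FSat, h x (by simp [fv]), h y (by simp [fv])]
  | dep => rfl
  | and φ ψ h1 h2 | or φ ψ h1 h2 | gdisj φ ψ h1 h2 =>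
    simp only [FSat, h1 fun v hv => h v (Or.inl hv), h2 fun v hv => h v (Or.inr hv)]
  | cneg φ ih => simp only [FSat, ih h]
  | ex v φ ih =>
    refine exists_congr fun m => ih fun u hu => ?_
    by_cases huv : u = v
    · simp [huv]
    · simpa [huv] using h u ⟨hu, huv⟩
  | al v φ ih =>
    refine forall_congr' fun m => ih fun u hu => ?_
    by_cases huv : u = v
    · simp [huv]
    · simpa [huv] using h u ⟨hu, huv⟩

theorem fv_finite {ι : Type} {ar : ι → ℕ} (φ : TS S ι ar) : (fv φ).Finite := by
  induction φ with
  | rel r v | nrel r v | dep i v => exact Set.finite_range v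
  | eq x y | neq x y => exact (Set.finite_singleton y).insert x
  | and φ ψ h1 h2 | or φ ψ h1 h2 | gdisj φ ψ h1 h2 => exact h1.union h2
  | cneg φ ih => exact ih
  | ex v φ ih | al v φ ih => exact ih.sdiff

/-- For sentences, truth is satisfaction by any single assignment. -/
theorem IsSentence.foTrue_iff {φ : FOF S} (hφ : IsSentence φ) (I : Interp S M) (s : ℕ → M) :
    FOTrue M I φ ↔ FSat M I s φ :=
  ⟨fun h => h s, fun h t => (fsat_congr I φ fun v hv => by
    rw [IsSentence] at hφ; simp [hφ] at hv).1 h⟩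

/-- Iterated universal quantification over a list of variables. -/
def als {ι : Type} {ar : ι → ℕ} (l : List ℕ) (φ : TS S ι ar) : TS S ι ar := l.foldr TS.al φ

theorem fv_exs {ι : Type} {ar : ι → ℕ} (l : List ℕ) (φ : TS S ι ar) :
    fv (exs l φ) = fv φ \ {v | v ∈ l} := by
  induction l with
  | nil => simp [exs]
  | cons a l ih =>
    have : fv (exs (a :: l) φ) = fv (exs l φ) \ {a} := rfl
    rw [this, ih]
    ext v
    simp only [Set.mem_sdiff, Set.mem_ofPred_eq, List.mem_cons, Set.mem_singleton_iff]
    tauto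

theorem fv_als {ι : Type} {ar : ι → ℕ} (l : List ℕ) (φ : TS S ι ar) :
    fv (als l φ) = fv φ \ {v | v ∈ l} := by
  induction l with
  | nil => simp [als]
  | cons a l ih =>
    have : fv (als (a :: l) φ) = fv (als l φ) \ {a} := rfl
    rw [this, ih]
    ext v
    simp only [Set.mem_sdiff, Set.mem_ofPred_eq, List.mem_cons, Set.mem_singleton_iff]
    tauto

theorem plain_exs {ι : Type} {ar : ι → ℕ} (l : List ℕ) {φ : TS S ι ar} (h : Plain φ) :
    Plain (exs l φ) := by
  induction l with
  | nil => exact h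
  | cons a l ih => exact ih

theorem plain_als {ι : Type} {ar : ι → ℕ} (l : List ℕ) {φ : TS S ι ar} (h : Plain φ) :
    Plain (als l φ) := by
  induction l with
  | nil => exact h
  | cons a l ih => exact ih

theorem fsat_exs {ι : Type} {ar : ι → ℕ} (I : Interp S M) (l : List ℕ) (φ : TS S ι ar)
    (s : ℕ → M) :
    FSat M I s (exs l φ) ↔ ∃ t : ℕ → M, (∀ v ∉ l, t v = s v) ∧ FSat M I t φ := by
  induction l generalizing s with
  | nil =>
    refine ⟨fun h => ⟨s, fun _ _ => rfl, h⟩, ?_⟩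
    rintro ⟨t, ht, h⟩
    obtain rfl : t = s := funext fun v => ht v (by simp)
    exact h
  | cons a l ih =>
    change (∃ m, FSat M I (Function.update s a m) (exs l φ)) ↔ _
    simp only [ih]
    constructor
    · rintro ⟨m, t, ht, h⟩
      refine ⟨t, fun v hv => ?_, h⟩
      simp only [List.mem_cons, not_or] at hv
      rw [ht v hv.2, Function.update_of_ne hv.1]
    · rintro ⟨t, ht, h⟩
      refine ⟨t a, t, fun v hv => ?_, h⟩
      by_cases hva : v = a
      · simp [hva]
      · rw [Function.update_of_ne hva, ht v (by simp [hva, hv])]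

theorem fsat_als {ι : Type} {ar : ι → ℕ} (I : Interp S M) (l : List ℕ) (φ : TS S ι ar)
    (s : ℕ → M) :
    FSat M I s (als l φ) ↔ ∀ t : ℕ → M, (∀ v ∉ l, t v = s v) → FSat M I t φ := by
  induction l generalizing s with
  | nil =>
    refine ⟨fun h t ht => ?_, fun h => h s fun _ _ => rfl⟩
    obtain rfl : t = s := funext fun v => ht v (by simp)
    exact h
  | cons a l ih =>
    change (∀ m, FSat M I (Function.update s a m) (als l φ)) ↔ _
    simp only [ih]
    constructor
    · intro h t ht
      refine h (t a) t fun v hv => ?_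
      by_cases hva : v = a
      · simp [hva]
      · rw [Function.update_of_ne hva, ht v (by simp [hva, hv])]
    · intro h m t ht
      refine h t fun v hv => ?_
      simp only [List.mem_cons, not_or] at hv
      rw [ht v hv.2, Function.update_of_ne hv.1]

/-- Every formula can be turned into a sentence by universal closure. -/
theorem exists_sentence (φ : FOF S) :
    ∃ ψ : FOF S, IsSentence ψ ∧ ∀ (M : Type) (I : Interp S M), FOTrue M I ψ ↔ FOTrue M I φ := by
  refine ⟨als (fv_finite φ).toFinset.toList φ, ?_, fun M I => ?_⟩
  · rw [IsSentence, fv_als]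
    ext v
    simp
  · simp only [FOTrue, fsat_als]
    exact ⟨fun h s => h s s fun _ _ => rfl, fun h _ t _ => h t⟩

end FirstOrder

section Definable

variable {S : Signature}

/-- A uniform family of properties of assignments is definable when it is given by a first-order
formula on all models with at least two elements. -/
def Dfn (P : ∀ M : Type, Interp S M → (ℕ → M) → Prop) : Prop :=
  ∃ χ : FOF S, ∀ (M : Type), Nontrivial M → ∀ (I : Interp S M) (s : ℕ → M),
    FSat M I s χ ↔ P M I s

variable {P Q : ∀ M : Type, Interp S M → (ℕ → M) → Prop}

theorem Dfn.congr (h : Dfn P)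
    (hPQ : ∀ (M : Type), Nontrivial M → ∀ (I : Interp S M) (s : ℕ → M), P M I s ↔ Q M I s) :
    Dfn Q :=
  let ⟨χ, hχ⟩ := h
  ⟨χ, fun M hM I s => (hχ M hM I s).trans (hPQ M hM I s)⟩

theorem dfn_fsat (χ : FOF S) : Dfn fun M I s => FSat M I s χ := ⟨χ, fun _ _ _ _ => Iff.rfl⟩

theorem dfn_eq (x y : ℕ) : Dfn (S := S) fun _ _ s => s x = s y := dfn_fsat (.eq x y)

theorem dfn_rel {k : ℕ} (r : S k) (v : Fin k → ℕ) :
    Dfn (S := S) fun _ I s => (fun i => s (v i)) ∈ I k r := dfn_fsat (.rel r v)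

theorem Dfn.not (h : Dfn P) : Dfn fun M I s => ¬ P M I s :=
  let ⟨χ, hχ⟩ := h
  ⟨.cneg χ, fun M hM I s => not_congr (hχ M hM I s)⟩

theorem Dfn.and (h : Dfn P) (h' : Dfn Q) : Dfn fun M I s => P M I s ∧ Q M I s :=
  let ⟨χ, hχ⟩ := h
  let ⟨χ', hχ'⟩ := h'
  ⟨.and χ χ', fun M hM I s => and_congr (hχ M hM I s) (hχ' M hM I s)⟩

theorem Dfn.or (h : Dfn P) (h' : Dfn Q) : Dfn fun M I s => P M I s ∨ Q M I s :=
  let ⟨χ, hχ⟩ := h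
  let ⟨χ', hχ'⟩ := h'
  ⟨.or χ χ', fun M hM I s => or_congr (hχ M hM I s) (hχ' M hM I s)⟩

theorem Dfn.imp (h : Dfn P) (h' : Dfn Q) : Dfn fun M I s => P M I s → Q M I s :=
  (h.not.or h').congr fun _ _ _ _ => imp_iff_not_or.symm

theorem Dfn.iff (h : Dfn P) (h' : Dfn Q) : Dfn fun M I s => P M I s ↔ Q M I s :=
  ((h.imp h').and (h'.imp h)).congr fun _ _ _ _ => iff_iff_implies_and_implies.symm

theorem Dfn.ex (v : ℕ) (h : Dfn P) : Dfn fun M I s => ∃ m, P M I (Function.update s v m) :=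
  let ⟨χ, hχ⟩ := h
  ⟨.ex v χ, fun M hM I _ => exists_congr fun _ => hχ M hM I _⟩

theorem Dfn.al (v : ℕ) (h : Dfn P) : Dfn fun M I s => ∀ m, P M I (Function.update s v m) :=
  let ⟨χ, hχ⟩ := h
  ⟨.al v χ, fun M hM I _ => forall_congr' fun _ => hχ M hM I _⟩

theorem dfn_true : Dfn (S := S) fun _ _ _ => True := (dfn_eq 0 0).congr (by simp)

theorem dfn_const (p : Prop) : Dfn (S := S) fun _ _ _ => p := by
  by_cases hp : p
  · exact dfn_true.congr (by simp [hp])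
  · exact dfn_true.not.congr (by simp [hp])

theorem dfn_exists {C : Type} [Finite C] {P : C → ∀ M : Type, Interp S M → (ℕ → M) → Prop}
    (h : ∀ c, Dfn (P c)) : Dfn fun M I s => ∃ c, P c M I s := by
  have key : ∀ l : List C, Dfn fun M I s => ∃ c ∈ l, P c M I s := by
    intro l
    induction l with
    | nil => exact dfn_true.not.congr (by simp)
    | cons a l ih => exact ((h a).or ih).congr (by simp)
  cases nonempty_fintype C
  exact (key Finset.univ.toList).congr (by simp)

theorem dfn_forall {C : Type} [Finite C] {P : C → ∀ M : Type, Interp S M → (ℕ → M) → Prop}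
    (h : ∀ c, Dfn (P c)) : Dfn fun M I s => ∀ c, P c M I s :=
  (dfn_exists fun c => (h c).not).not.congr fun _ _ _ _ => by simp

/-- Definability is invariant under injective renaming of variables. -/
theorem Dfn.comp (h : Dfn P) {σ : ℕ → ℕ} (hσ : Function.Injective σ) :
    Dfn fun M I s => P M I (s ∘ σ) := by
  obtain ⟨χ, hχ⟩ := h
  suffices h : Dfn fun M I s => FSat M I (s ∘ σ) χ from h.congr fun M hM I s => hχ M hM I _
  clear hχ
  induction χ with
  | rel r v => exact dfn_rel r (σ ∘ v)
  | nrel r v => exact (dfn_rel r (σ ∘ v)).not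
  | eq x y => exact dfn_eq (σ x) (σ y)
  | neq x y => exact (dfn_eq (σ x) (σ y)).not
  | dep i => exact i.elim
  | and φ ψ h1 h2 => exact h1.and h2
  | or φ ψ h1 h2 | gdisj φ ψ h1 h2 => exact h1.or h2
  | cneg φ ih => exact ih.not
  | ex v φ ih =>
    exact (ih.ex (σ v)).congr fun M _ I s => by
      simp only [FSat, Function.update_comp_eq_of_injective _ hσ]
  | al v φ ih =>
    exact (ih.al (σ v)).congr fun M _ I s => by
      simp only [FSat, Function.update_comp_eq_of_injective _ hσ]

/-- Definability of a property of two assignments, the first occupying the even variables and the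
second one the odd variables. -/
def Dfn₂ (P : ∀ M : Type, Interp S M → (ℕ → M) → (ℕ → M) → Prop) : Prop :=
  Dfn fun M I w => P M I (fun v => w (2 * v)) (fun v => w (2 * v + 1))

/-- Existential quantification over the whole second assignment followed by universal
quantification over the whole first one preserves definability. -/
theorem Dfn₂.exists_forall {P : ∀ M : Type, Interp S M → (ℕ → M) → (ℕ → M) → Prop}
    (h : Dfn₂ P) : Dfn fun M I _ => ∃ a, ∀ s, P M I s a := by
  obtain ⟨χ, hχ⟩ := h
  let O : List ℕ := (fv_finite χ).toFinset.toList.filter fun v => v % 2 = 1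
  let E : List ℕ := (fv_finite χ).toFinset.toList.filter fun v => v % 2 = 0
  have hO : ∀ v, v ∈ O ↔ v ∈ fv χ ∧ v % 2 = 1 := by simp [O]
  have hE : ∀ v, v ∈ E ↔ v ∈ fv χ ∧ v % 2 = 0 := by simp [E]
  refine ⟨exs O (als E χ), fun M hM I w => ?_⟩
  simp only [fsat_exs, fsat_als]
  constructor
  · rintro ⟨t, -, ht⟩
    refine ⟨fun v => t (2 * v + 1), fun s => ?_⟩
    let w' : ℕ → M := fun v => if v % 2 = 0 then s (v / 2) else t v
    have hw : FSat M I w' χ := by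
      refine (fsat_congr I χ fun v hv => ?_).1
        (ht (fun v => if v ∈ E then s (v / 2) else t v) fun v hv => by simp [hv])
      by_cases h2 : v % 2 = 0
      · simp [w', hE, hv, h2]
      · simp [w', hE, h2]
    have := (hχ M hM I w').1 hw
    convert this using 2 with v v
    · simp [w']
    · simp [w', show (2 * v + 1) % 2 = 1 by omega]
  · rintro ⟨a, ha⟩
    refine ⟨fun v => if v ∈ O then a (v / 2) else w v, fun v hv => by simp [hv], fun t ht => ?_⟩
    let w' : ℕ → M := fun v => if v % 2 = 0 then t v else a (v / 2)
    have hw : FSat M I w' χ := by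
      rw [hχ M hM]
      convert ha fun v => t (2 * v) using 2 with v v
      · simp [w']
      · simp [w', show (2 * v + 1) % 2 = 1 by omega, show (2 * v + 1) / 2 = v by omega]
    refine (fsat_congr I χ fun v hv => ?_).1 hw
    by_cases h2 : v % 2 = 0
    · simp [w', h2]
    · have h1 : v % 2 = 1 := by omega
      rw [ht v (by simp [hE, h2])]
      simp [w', h1, hO, hv]

theorem update_even {M : Type} (w : ℕ → M) (v : ℕ) (m : M) :
    (fun u => Function.update w (2 * v) m (2 * u)) =
      Function.update (fun u => w (2 * u)) v m :=
  Function.update_comp_eq_of_injective w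
    (show Function.Injective fun v : ℕ => 2 * v from fun a b h => by simpa using h) v m

theorem update_even_odd {M : Type} (w : ℕ → M) (v : ℕ) (m : M) :
    (fun u => Function.update w (2 * v) m (2 * u + 1)) = fun u => w (2 * u + 1) :=
  funext fun _ => Function.update_of_ne (by omega) _ _

/-- Replacing the relation symbol of a formula by a definable relation with parameters. -/
theorem dfn₂_fsat_interpR {k : ℕ} (χ : FOF (SigR k))
    {T : ∀ M : Type, Interp S M → (Fin k → M) → (ℕ → M) → Prop}
    (hT : ∀ v : Fin k → ℕ, Dfn₂ fun M I s a => T M I (fun i => s (v i)) a) :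
    Dfn₂ fun M I s a => FSat M (interpR {f | T M I f a}) s χ := by
  induction χ with
  | rel r v =>
    obtain ⟨rfl⟩ := r
    exact hT v
  | nrel r v =>
    obtain ⟨rfl⟩ := r
    exact Dfn.not (hT v)
  | eq x y => exact dfn_eq (2 * x) (2 * y)
  | neq x y => exact (dfn_eq (2 * x) (2 * y)).not
  | dep i => exact i.elim
  | and φ ψ h1 h2 => exact Dfn.and h1 h2
  | or φ ψ h1 h2 | gdisj φ ψ h1 h2 => exact Dfn.or h1 h2
  | cneg φ ih => exact Dfn.not ih
  | ex v φ ih =>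
    refine (Dfn.ex (2 * v) ih).congr fun M _ I s => ?_
    simp only [FSat, update_even, update_even_odd]
  | al v φ ih =>
    refine (Dfn.al (2 * v) ih).congr fun M _ I s => ?_
    simp only [FSat, update_even, update_even_odd]

end Definable

section ModelTheory

open FirstOrder Cardinal

/-- The relational first-order language of a signature. -/
abbrev sigLang (S : Signature) : Language := ⟨fun _ => Empty, S⟩

/-- An interpretation of a signature as a first-order structure. -/
abbrev interpStructure {S : Signature} {M : Type} (I : Interp S M) : (sigLang S).Structure M where
  funMap f := f.elim
  RelMap r x := x ∈ I _ r

variable {S : Signature}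

theorem exists_formula (χ : FOF S) :
    ∃ F : (sigLang S).Formula ℕ, ∀ (M : Type) (I : Interp S M) (s : ℕ → M),
      letI := interpStructure I
      F.Realize s ↔ FSat M I s χ := by
  have quant : ∀ (v : ℕ) (F : (sigLang S).Formula ℕ), ∃ G : (sigLang S).BoundedFormula ℕ 1,
      ∀ (M : Type) (I : Interp S M) (s : ℕ → M) (m : M),
        letI := interpStructure I
        G.Realize s (Fin.snoc default m) ↔ F.Realize (Function.update s v m) := by
    intro v F
    refine ⟨Language.BoundedFormula.relabel (n := 1)
      (fun u => if u = v then Sum.inr 0 else Sum.inl u) F, fun M I s m => ?_⟩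
    let := interpStructure I
    rw [Language.BoundedFormula.realize_relabel, Language.Formula.Realize]
    refine iff_of_eq (congr_arg₂ _ (funext fun u => ?_) (Subsingleton.elim _ _))
    by_cases h : u = v
    · simp [h, Fin.snoc]
    · simp [h]
  induction χ with
  | rel r v =>
    exact ⟨Language.Relations.formula (L := sigLang S) r fun i => Language.Term.var (v i),
      fun M I s => by
        let := interpStructure I
        rw [Language.Formula.realize_rel]; rfl⟩
  | nrel r v =>
    exact ⟨(Language.Relations.formula (L := sigLang S) r fun i => Language.Term.var (v i)).not,
      fun M I s => by
        let := interpStructure I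
        rw [Language.Formula.realize_not, Language.Formula.realize_rel]; rfl⟩
  | eq x y =>
    exact ⟨Language.Term.equal (Language.Term.var x) (Language.Term.var y), fun M I s => by
      let := interpStructure I
      rw [Language.Formula.realize_equal]; rfl⟩
  | neq x y =>
    exact ⟨(Language.Term.equal (Language.Term.var x) (Language.Term.var y)).not, fun M I s => by
      let := interpStructure I
      rw [Language.Formula.realize_not, Language.Formula.realize_equal]; rfl⟩
  | dep i => exact i.elim
  | and φ ψ h1 h2 =>
    obtain ⟨F, hF⟩ := h1
    obtain ⟨G, hG⟩ := h2
    exact ⟨F ⊓ G, fun M I s =>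
      let := interpStructure I
      Language.Formula.realize_inf.trans
      (and_congr (hF M I s) (hG M I s))⟩
  | or φ ψ h1 h2 | gdisj φ ψ h1 h2 =>
    obtain ⟨F, hF⟩ := h1
    obtain ⟨G, hG⟩ := h2
    exact ⟨F ⊔ G, fun M I s =>
      let := interpStructure I
      Language.Formula.realize_sup.trans
      (or_congr (hF M I s) (hG M I s))⟩
  | cneg φ ih =>
    obtain ⟨F, hF⟩ := ih
    exact ⟨F.not, fun M I s =>
      let := interpStructure I
      Language.Formula.realize_not.trans (not_congr (hF M I s))⟩
  | ex v φ ih =>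
    obtain ⟨F, hF⟩ := ih
    obtain ⟨G, hG⟩ := quant v F
    exact ⟨G.ex, fun M I s =>
      let := interpStructure I
      Language.BoundedFormula.realize_ex.trans
      (exists_congr fun m => (hG M I s m).trans (hF M I _))⟩
  | al v φ ih =>
    obtain ⟨F, hF⟩ := ih
    obtain ⟨G, hG⟩ := quant v F
    exact ⟨G.all, fun M I s =>
      let := interpStructure I
      Language.BoundedFormula.realize_all.trans
      (forall_congr' fun m => (hG M I s m).trans (hF M I _))⟩

/-- The restriction of an interpretation to a subset of the domain. -/
def Interp.restrict {M : Type} (I : Interp S M) (N : Set M) : Interp S N :=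
  fun k r => {x | (fun i => (x i : M)) ∈ I k r}

/-- The downward Löwenheim–Skolem theorem for a countable signature. -/
theorem exists_countable_elementary [∀ k, Countable (S k)] {M : Type} [Infinite M]
    (I : Interp S M) (A : Set M) (hA : A.Countable) :
    ∃ N : Set M, A ⊆ N ∧ N.Countable ∧ N.Infinite ∧ ∀ (φ : FOF S) (s : ℕ → N),
      FSat N (I.restrict N) s φ ↔ FSat M I (fun v => (s v : M)) φ := by
  let := interpStructure I
  have hc : (sigLang S).card ≤ ℵ₀ := by
    have : ∀ l, Countable ((sigLang S).Functions l) := fun l =>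
      inferInstanceAs (Countable Empty)
    have : ∀ l, Countable ((sigLang S).Relations l) := fun l =>
      inferInstanceAs (Countable (S l))
    have : Countable (sigLang S).Symbols :=
      inferInstanceAs (Countable ((Σ l, (sigLang S).Functions l) ⊕ Σ l, (sigLang S).Relations l))
    exact mk_le_aleph0
  obtain ⟨N, hAN, hN⟩ := Language.exists_elementarySubstructure_card_eq (sigLang S) A
    aleph0.{0} le_rfl
    (by simpa using hA.le_aleph0) (by simpa using hc) (by simp)
  replace hN : #N = ℵ₀ := by simpa using hN
  have h1 : Countable N := mk_le_aleph0_iff.1 hN.le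
  have h2 : Infinite N := infinite_iff.2 hN.ge
  refine ⟨N, hAN, Set.countable_coe_iff.1 h1, Set.infinite_coe_iff.1 h2, fun φ s => ?_⟩
  obtain ⟨F, hF⟩ := exists_formula φ
  have hs : N.inducedStructure = interpStructure (I.restrict (N : Set M)) :=
    Language.Structure.ext (funext fun k => funext fun f => f.elim) rfl
  have key : F.Realize (M := ↥N) s ↔ F.Realize fun v => (s v : M) :=
    (N.subtype.map_formula F s).symm
  rw [hs] at key
  exact ((hF _ (I.restrict _) s).symm.trans key).trans (hF M I _)

/-- Compactness, in the form of a limit of a sequence of models. -/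
theorem exists_limit_model (M : ℕ → Type) [∀ n, Nonempty (M n)] (I : ∀ n, Interp S (M n)) :
    ∃ (N : Type) (J : Interp S N), Nonempty N ∧ ∀ φ : FOF S, IsSentence φ →
      (∃ n₀, ∀ n ≥ n₀, FOTrue (M n) (I n) φ) → FOTrue N J φ := by
  let := fun n => interpStructure (I n)
  let u : Ultrafilter ℕ := Filter.hyperfilter ℕ
  let N := (u : Filter ℕ).Product M
  have hu : (Filter.atTop : Filter ℕ) ≥ u := Nat.hyperfilter_le_atTop
  let J : Interp S N := fun k r => {x | Language.Structure.RelMap (L := sigLang S) r x}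
  have x₀ : ∀ n, M n := fun n => Classical.arbitrary _
  have hJ : (Language.Ultraproduct.structure : (sigLang S).Structure N) = interpStructure J := by
    refine Language.Structure.ext (funext fun k => funext fun f => f.elim) rfl
  refine ⟨N, J, Language.Ultraproduct.Product.instNonempty, fun φ hφ h => ?_⟩
  obtain ⟨F, hF⟩ := exists_formula φ
  have key := (Language.Ultraproduct.realize_formula_cast (u := u) F fun _ => x₀).2
    (hu (Filter.eventually_atTop.2 (h.imp fun n₀ hn n hnn => (hF _ _ _).2 (hn n hnn _))))
  refine (hφ.foTrue_iff J fun _ => Quotient.mk ((u : Filter ℕ).productSetoid M) x₀).2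
    ((hF N J _).1 ?_)
  rw [← hJ]
  exact key

end ModelTheory

section Patterns

/-- Equality patterns of a `k`-tuple together with an `n`-tuple of parameters. -/
abbrev Pattern (k n : ℕ) : Type := Fin k ⊕ Fin n → Fin k ⊕ Fin n → Prop

/-- The equality pattern realized by a tuple and some parameters. -/
def pattern {M : Type} {k n : ℕ} (f : Fin k → M) (a : Fin n → M) : Pattern k n :=
  fun p q => Sum.elim f a p = Sum.elim f a q

/-- The relation consisting of the tuples whose equality pattern over the parameters `a` is in
`Θ`. -/
def patternSet {M : Type} {k n : ℕ} (Θ : Set (Pattern k n)) (a : Fin n → M) :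
    Set (Fin k → M) := {f | pattern f a ∈ Θ}

theorem exists_perm_apply_eq {K M : Type} [Finite K] (t t' : K → M)
    (h : ∀ p q, t p = t q ↔ t' p = t' q) : ∃ τ : Equiv.Perm M, ∀ p, τ (t p) = t' p := by
  obtain ⟨n, ⟨e⟩⟩ := Finite.exists_equiv_fin (Set.range t)
  choose c hc using fun x : Set.range t => x.2
  let x : Fin n ↪ M := ⟨fun i => (e.symm i : M), Subtype.val_injective.comp e.symm.injective⟩
  let y : Fin n ↪ M := ⟨fun i => t' (c (e.symm i)), fun i j hij => by
    have := (h _ _).2 hij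
    rw [hc, hc] at this
    exact e.symm.injective (Subtype.ext this)⟩
  have := (Equiv.Perm.isMultiplyPretransitive M n).exists_smul_eq x y
  obtain ⟨τ, hτ⟩ := this
  refine ⟨τ, fun p => ?_⟩
  have h1 := DFunLike.congr_fun hτ (e ⟨t p, p, rfl⟩)
  have h2 : τ (x (e ⟨t p, p, rfl⟩)) = y (e ⟨t p, p, rfl⟩) := h1
  simp only [x, y, Function.Embedding.coeFn_mk, Equiv.symm_apply_apply] at h2
  rw [h2]
  exact (h _ _).1 (by rw [hc]; simp)

theorem exists_perm_of_pattern_eq {M : Type} {k n : ℕ} {f g : Fin k → M} {a : Fin n → M}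
    (h : pattern g a = pattern f a) :
    ∃ τ : Equiv.Perm M, (∀ i, τ (a i) = a i) ∧ ∀ i, τ (g i) = f i := by
  obtain ⟨τ, hτ⟩ := exists_perm_apply_eq (Sum.elim g a) (Sum.elim f a)
    fun p q => iff_of_eq (congr_fun (congr_fun h p) q)
  exact ⟨τ, fun i => hτ (Sum.inr i), fun i => hτ (Sum.inl i)⟩

end Patterns

section Generic

/-- A permutation together with a finite set of points at which it is considered as decided. -/
structure PartialPerm (M : Type) where
  /-- The set of decided points. -/
  dom : Finset M
  /-- The underlying permutation. -/
  perm : Equiv.Perm M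

instance (M : Type) : Preorder (PartialPerm M) where
  le p q := p.dom ⊆ q.dom ∧ ∀ m ∈ p.dom, p.perm m = q.perm m
  le_refl p := ⟨subset_rfl, fun _ _ => rfl⟩
  le_trans p q r h h' :=
    ⟨h.1.trans h'.1, fun m hm => (h.2 m hm).trans (h'.2 m (h.1 hm))⟩

/-- A generic permutation of a countable set, avoiding countably many requirements of the form
`R` is mapped into `U j`. -/
theorem exists_perm_avoiding {M J : Type} [Countable M] [Countable J] {k : ℕ}
    (R : Set (Fin k → M)) (U : J → Set (Fin k → M))
    (h : ∀ (A : Finset M) (σ : Equiv.Perm M) (j : J), ∃ τ : Equiv.Perm M,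
      (∀ m ∈ A, τ m = m) ∧ ∃ f ∈ R, (fun i => σ (τ (f i))) ∉ U j) :
    ∃ σ : Equiv.Perm M, ∀ j, ∃ f ∈ R, (fun i => σ (f i)) ∉ U j := by
  classical
  let C₁ : M → Order.Cofinal (PartialPerm M) := fun m =>
    ⟨{p | m ∈ p.dom}, fun p => ⟨⟨insert m p.dom, p.perm⟩, by simp,
      Finset.subset_insert _ _, fun _ _ => rfl⟩⟩
  let C₂ : M → Order.Cofinal (PartialPerm M) := fun m =>
    ⟨{p | ∃ x ∈ p.dom, p.perm x = m}, fun p => ⟨⟨insert (p.perm.symm m) p.dom, p.perm⟩,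
      ⟨p.perm.symm m, by simp⟩, Finset.subset_insert _ _, fun _ _ => rfl⟩⟩
  let C₃ : J → Order.Cofinal (PartialPerm M) := fun j =>
    ⟨{p | ∃ f ∈ R, (∀ i, f i ∈ p.dom) ∧ (fun i => p.perm (f i)) ∉ U j}, fun p => by
      obtain ⟨τ, hτ, f, hf, hfU⟩ := h p.dom p.perm j
      refine ⟨⟨p.dom ∪ Finset.univ.image f, τ.trans p.perm⟩, ⟨f, hf, fun i => ?_, hfU⟩,
        Finset.subset_union_left, fun m hm => ?_⟩
      · simp
      · simp [hτ m hm]⟩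
  have : Encodable ((M ⊕ M) ⊕ J) := Encodable.ofCountable _
  let C : (M ⊕ M) ⊕ J → Order.Cofinal (PartialPerm M) := Sum.elim (Sum.elim C₁ C₂) C₃
  let q : ℕ → PartialPerm M := Order.sequenceOfCofinals ⟨∅, 1⟩ C
  have hmono : Monotone q := Order.sequenceOfCofinals.monotone _ _
  have hmeet : ∀ i, ∃ n, q n ∈ C i := fun i =>
    ⟨_, Order.sequenceOfCofinals.encode_mem _ C i⟩
  choose N hN using fun m => hmeet (Sum.inl (Sum.inl m))
  replace hN : ∀ m, m ∈ (q (N m)).dom := hN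
  let g : M → M := fun m => (q (N m)).perm m
  have hg : ∀ n m, m ∈ (q n).dom → (q n).perm m = g m := by
    intro n m hm
    rcases le_total n (N m) with h | h
    · exact (hmono h).2 m hm
    · exact ((hmono h).2 m (hN m)).symm
  have hbij : Function.Bijective g := by
    constructor
    · intro x y hxy
      have hx := (hmono (le_max_left (N x) (N y))).1 (hN x)
      have hy := (hmono (le_max_right (N x) (N y))).1 (hN y)
      rw [← hg _ x hx, ← hg _ y hy] at hxy
      exact (q _).perm.injective hxy
    · intro m
      obtain ⟨n, x, hx, hxm⟩ := hmeet (Sum.inl (Sum.inr m))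
      exact ⟨x, (hg n x hx).symm.trans hxm⟩
  refine ⟨Equiv.ofBijective g hbij, fun j => ?_⟩
  obtain ⟨n, f, hf, hfn, hfU⟩ := hmeet (Sum.inr j)
  refine ⟨f, hf, ?_⟩
  simpa only [Equiv.ofBijective_apply, ← hg n _ (hfn _)] using hfU

end Generic

section Support

variable {k : ℕ} {D : DepPred k}

theorem IsoClosed.iff (hiso : IsoClosed D) {M N : Type} (e : M ≃ N) {R : Set (Fin k → M)}
    {R' : Set (Fin k → N)} (h : ∀ f, f ∈ R ↔ (fun i => e (f i)) ∈ R') : D M R ↔ D N R' := by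
  have key : ∀ {M N : Type} (e : M ≃ N) {R : Set (Fin k → M)} {R' : Set (Fin k → N)},
      (∀ f, f ∈ R ↔ (fun i => e (f i)) ∈ R') → D M R → D N R' := by
    intro M N e R R' h hR
    convert hiso M N e R hR
    ext f
    constructor
    · exact fun hf => ⟨fun i => e.symm (f i), by simpa [h] using hf, by ext; simp⟩
    · rintro ⟨g, hg, rfl⟩
      exact (h g).1 hg
  exact ⟨key e h, key e.symm fun f => by simp [h]⟩

/-- If countably many relations in `D` cover all relations in `D`, then each relation in `D` is
contained in one with a finite support. -/
theorem exists_patternSet_of_countable_cover (hiso : IsoClosed D) (hdc : DownwardsClosed D)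
    {M J : Type} [Countable M] [Countable J] (U : J → Set (Fin k → M)) (hU : ∀ j, D M (U j))
    (hcov : ∀ R, D M R → ∃ j, R ⊆ U j) {R : Set (Fin k → M)} (hR : D M R) :
    ∃ (n : ℕ) (Θ : Set (Pattern k n)) (a : Fin n → M),
      R ⊆ patternSet Θ a ∧ D M (patternSet Θ a) := by
  by_contra! hno
  obtain ⟨σ, hσ⟩ := exists_perm_avoiding R U fun A σ j => by
    by_contra! hA
    let a : Fin A.card → M := fun i => (A.equivFin.symm i : M)
    refine hno A.card {e | ∃ f ∈ R, pattern f a = e} a (fun f hf => ⟨f, hf, rfl⟩) ?_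
    have hσU : D M {f | (fun i => σ (f i)) ∈ U j} :=
      (hiso.iff σ fun f => Iff.rfl).2 (hU j)
    refine hdc M _ _ hσU ?_
    rintro f ⟨g, hg, hgf⟩
    obtain ⟨τ, hτa, hτ⟩ := exists_perm_of_pattern_eq hgf
    have := hA τ (fun m hm => by simpa [a] using hτa (A.equivFin ⟨m, hm⟩)) g hg
    simp only [hτ] at this
    exact this
  obtain ⟨j, hj⟩ := hcov {f | (fun i => σ.symm (f i)) ∈ R}
    ((hiso.iff σ.symm fun f => Iff.rfl).2 hR)
  obtain ⟨f, hf, hfU⟩ := hσ j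
  exact hfU (hj (by simpa using hf))

end Support

section TeamSemantics

variable {S : Signature} {ι : Type} {ar : ι → ℕ} {M : Type}

theorem tSat_exs (I : Interp S M) (A : ∀ i, Set (Fin (ar i) → M) → Prop) (l : List ℕ)
    (φ : TS S ι ar) (X : Set (ℕ → M)) :
    TSat M I A (exs l φ) X ↔ ∃ X' : Set (ℕ → M), TSat M I A φ X' ∧
      (∀ s ∈ X, ∃ t ∈ X', ∀ v ∉ l, t v = s v) ∧ (∀ t ∈ X', ∃ s ∈ X, ∀ v ∉ l, t v = s v) := by
  induction l generalizing X with
  | nil =>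
    constructor
    · exact fun h => ⟨X, h, fun s hs => ⟨s, hs, fun _ _ => rfl⟩,
        fun s hs => ⟨s, hs, fun _ _ => rfl⟩⟩
    · rintro ⟨X', h, h1, h2⟩
      obtain rfl : X' = X := by
        ext s
        constructor
        · intro hs
          obtain ⟨t, ht, hst⟩ := h2 s hs
          rwa [show s = t from funext fun v => hst v (by simp)]
        · intro hs
          obtain ⟨t, ht, hst⟩ := h1 s hs
          rwa [show s = t from funext fun v => (hst v (by simp)).symm]
      exact h
  | cons a l ih =>
    change (∃ H : (ℕ → M) → Set M, (∀ s ∈ X, (H s).Nonempty) ∧ TSat M I A (exs l φ) _) ↔ _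
    simp only [ih]
    constructor
    · rintro ⟨H, hH, X', hX', h1, h2⟩
      refine ⟨X', hX', fun s hs => ?_, fun t ht => ?_⟩
      · obtain ⟨m, hm⟩ := hH s hs
        obtain ⟨t, ht, hts⟩ := h1 (Function.update s a m) ⟨s, hs, m, hm, rfl⟩
        refine ⟨t, ht, fun v hv => ?_⟩
        simp only [List.mem_cons, not_or] at hv
        rw [hts v hv.2, Function.update_of_ne hv.1]
      · obtain ⟨_, ⟨s, hs, m, -, rfl⟩, hts⟩ := h2 t ht
        refine ⟨s, hs, fun v hv => ?_⟩
        simp only [List.mem_cons, not_or] at hv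
        rw [hts v hv.2, Function.update_of_ne hv.1]
    · rintro ⟨X', hX', h1, h2⟩
      have key : ∀ s t : ℕ → M, (∀ v ∉ a :: l, t v = s v) → ∀ v ∉ l,
          t v = Function.update s a (t a) v := fun s t h v hv => by
        by_cases hva : v = a
        · simp [hva]
        · rw [Function.update_of_ne hva, h v (by simp [hva, hv])]
      refine ⟨fun s => {m | ∃ t ∈ X', t a = m ∧ ∀ v ∉ a :: l, t v = s v}, fun s hs => ?_,
        X', hX', ?_, fun t ht => ?_⟩
      · obtain ⟨t, ht, hts⟩ := h1 s hs
        exact ⟨t a, t, ht, rfl, hts⟩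
      · rintro _ ⟨s, hs, m, ⟨t, ht, rfl, hts⟩, rfl⟩
        exact ⟨t, ht, key s t hts⟩
      · obtain ⟨s, hs, hts⟩ := h2 t ht
        exact ⟨_, ⟨s, hs, t a, ⟨t, ht, rfl, hts⟩, rfl⟩, key s t hts⟩

theorem setOf_update_univ (v : ℕ) :
    {s' : ℕ → M | ∃ s ∈ (Set.univ : Set (ℕ → M)), ∃ m : M, s' = Function.update s v m} =
      Set.univ :=
  Set.eq_univ_of_forall fun s => ⟨s, trivial, s v, by simp⟩

theorem tTrue_al (I : Interp S M) (A : ∀ i, Set (Fin (ar i) → M) → Prop) (v : ℕ)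
    (φ : TS S ι ar) : TTrue M I A (.al v φ) ↔ TTrue M I A φ := by
  rw [TTrue, TSat, setOf_update_univ, TTrue]

theorem tTrue_als (I : Interp S M) (A : ∀ i, Set (Fin (ar i) → M) → Prop) (l : List ℕ)
    (φ : TS S ι ar) : TTrue M I A (als l φ) ↔ TTrue M I A φ := by
  induction l with
  | nil => rfl
  | cons a l ih => exact (tTrue_al I A a (als l φ)).trans ih

end TeamSemantics

section SingleDependency

variable {k : ℕ} {D : DepPred k}

/-- A strongly first order, downwards closed dependency is first order. -/
theorem SFOd.firstOrderDep (hsfo : SFOd D) (hdc : DownwardsClosed D) : FirstOrderDep D := by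
  let R₀ : SigR k k := ⟨rfl⟩
  let x : Fin k → ℕ := fun i => i
  let φ : TS (SigR k) Unit fun _ => k := .or (.nrel R₀ x) (.dep () x)
  obtain ⟨ψ, hψ, hφψ⟩ := hsfo (SigR k) (als (List.range k) φ)
    (by
      rw [IsSentence, fv_als]
      ext v
      simp only [φ, fv, Set.union_self, Set.mem_sdiff, Set.mem_range, Set.mem_ofPred_eq,
        List.mem_range, Set.mem_empty_iff_false, iff_false, not_and, not_not]
      rintro ⟨i, rfl⟩
      exact i.2)
    (plain_als _ ⟨⟨trivial, trivial⟩, trivial, trivial⟩)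
  refine ⟨ψ, hψ, fun M hM R => ?_⟩
  rw [← hφψ M hM, tTrue_als]
  constructor
  · intro hR
    refine ⟨{s | (fun i => s (x i)) ∉ R}, {s | (fun i => s (x i)) ∈ R}, ?_, fun s hs => hs, ?_⟩
    · ext s
      simp [em']
    · refine hdc M R _ hR ?_
      rintro _ ⟨s, hs, rfl⟩
      exact hs
  · rintro ⟨Y, Z, hYZ, hY, hZ⟩
    refine hdc M _ R hZ fun f hf => ?_
    let s : ℕ → M := overrideFin k f fun _ => Classical.arbitrary M
    have hs : f = fun i => s (x i) := by
      ext i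
      simp [s, x, overrideFin]
    rcases (hYZ ▸ trivial : s ∈ Y ∪ Z) with h | h
    · exact absurd (hs ▸ hf) (hY s h)
    · exact ⟨s, h, hs⟩

/-- The signature with a unary predicate and a `k + 1`-ary relation symbol. -/
def SigPE (k : ℕ) : Signature := fun n => PLift (n = 1) ⊕ PLift (n = k + 1)

/-- The unary predicate of `SigPE`. -/
def symP (k : ℕ) : SigPE k 1 := Sum.inl ⟨rfl⟩

/-- The relation symbol of `SigPE`. -/
def symE (k : ℕ) : SigPE k (k + 1) := Sum.inr ⟨rfl⟩

instance (k n : ℕ) : Countable (SigPE k n) :=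
  inferInstanceAs (Countable (PLift (n = 1) ⊕ PLift (n = k + 1)))

/-- Some relation in the relativization of `D` to `P` meets all the sets `E(·, z)` for `z`
outside of `P`. -/
def HasTransversal (D : DepPred k) (N : Type) (I : Interp (SigPE k) N) : Prop :=
  ∃ R : Set (Fin k → N), relSem D (symP k) N I R ∧
    ∀ z ∉ PSet I (symP k), ∃ f ∈ R, (Fin.snoc f z : Fin (k + 1) → N) ∈ I _ (symE k)

theorem DownwardsClosed.relSem (hdc : DownwardsClosed D) {S : Signature} {P : S 1} {M : Type}
    {I : Interp S M} {R R' : Set (Fin k → M)} (hR : relSem D P M I R) (h : R' ⊆ R) :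
    relSem D P M I R' :=
  ⟨fun f hf => hR.1 f (h hf), hdc _ _ _ hR.2 fun _ hg => h hg⟩

/-- The existence of a transversal in `D` is a first order property. -/
theorem hasTransversal_firstOrder (hdc : DownwardsClosed D) (hrel : Relativizable1 D)
    (hsfo : SFOd D) : ∃ χ : FOF (SigPE k), IsSentence χ ∧
      ∀ (N : Type), Nontrivial N → ∀ I : Interp (SigPE k) N,
        HasTransversal D N I ↔ FOTrue N I χ := by
  let θ : TS (SigPE k) Unit fun _ => k :=
    .and (.rel (symE k) fun i => i) (.dep () fun i => i)
  let φ : TS (SigPE k) Unit fun _ => k :=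
    .or (.rel (symP k) fun _ => k) (exs (List.range k) θ)
  have hθ : Plain (exs (List.range k) θ) := plain_exs _ ⟨⟨trivial, trivial⟩, trivial, trivial⟩
  have hφs : IsSentence (TS.al k φ) := by
    rw [IsSentence, fv]
    simp only [φ, fv, fv_exs, θ]
    ext v
    simp only [Set.mem_sdiff, Set.mem_union, Set.mem_range, Set.mem_ofPred_eq, List.mem_range,
      Set.mem_singleton_iff, Set.mem_empty_iff_false, iff_false, not_and, not_not]
    rintro (⟨i, rfl⟩ | ⟨⟨i, rfl⟩ | ⟨i, rfl⟩, hi⟩)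
    · rfl
    · omega
    · omega
  obtain ⟨ψ, hψ, hψp, hφψ⟩ := hrel (SigPE k) (symP k) (.al k φ) hφs
    ⟨⟨trivial, hθ.1⟩, trivial, hθ.2⟩
  obtain ⟨χ, hχ, hψχ⟩ := hsfo (SigPE k) ψ hψ hψp
  refine ⟨χ, hχ, fun N hN I => ?_⟩
  rw [← hψχ N hN I, ← hφψ N hN I, tTrue_al]
  constructor
  · rintro ⟨R, hR, hz⟩
    refine ⟨{s | s k ∈ PSet I (symP k)}, {s | s k ∉ PSet I (symP k)}, ?_, fun s hs => hs,
      (tSat_exs _ _ _ _ _).2 ⟨{s | s k ∉ PSet I (symP k) ∧ (fun i : Fin k => s i) ∈ R ∧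
        (fun i : Fin (k + 1) => s i) ∈ I _ (symE k)}, ⟨fun s hs => hs.2.2, ?_⟩, fun s hs => ?_,
        fun s hs => ⟨s, hs.1, fun _ _ => rfl⟩⟩⟩
    · ext s
      simp [em]
    · refine hdc.relSem hR ?_
      rintro _ ⟨s, hs, rfl⟩
      exact hs.2.1
    · obtain ⟨f, hf, hE⟩ := hz (s k) hs
      have h1 : (fun i : Fin k => overrideFin k f s i) = f := by
        ext i
        simp [overrideFin]
      have h2 : (fun i : Fin (k + 1) => overrideFin k f s i) = Fin.snoc f (s k) := by
        ext i
        refine Fin.lastCases ?_ (fun i => ?_) i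
        · simp [overrideFin]
        · simp [overrideFin]
      refine ⟨overrideFin k f s, ⟨?_, ?_, ?_⟩, fun v hv => ?_⟩
      · simpa [overrideFin] using hs
      · rwa [h1]
      · rwa [h2]
      · simp only [List.mem_range] at hv
        simp [overrideFin, hv]
  · rintro ⟨Y, Z, hYZ, hY, hZ⟩
    obtain ⟨X, ⟨hE, hD⟩, hX, -⟩ := (tSat_exs _ _ _ _ _).1 hZ
    refine ⟨_, hD, fun z hz => ?_⟩
    rcases (hYZ ▸ trivial : (fun _ => z) ∈ Y ∪ Z) with h | h
    · exact absurd (hY _ h) hz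
    · obtain ⟨s, hs, hsz⟩ := hX _ h
      refine ⟨_, ⟨s, hs, rfl⟩, ?_⟩
      convert hE s hs using 1
      ext i
      refine Fin.lastCases ?_ (fun i => ?_) i
      · simp [hsz k (by simp)]
      · simp

/-- On countably infinite domains, a relativizable and strongly first order dependency is covered
by countably many of its relations. -/
theorem exists_countable_cover (hiso : IsoClosed D) (hdc : DownwardsClosed D)
    (hrel : Relativizable1 D) (hsfo : SFOd D) (M : Type) [Countable M] [Infinite M] :
    ∃ (J : Type) (U : J → Set (Fin k → M)), Countable J ∧ (∀ j, D M (U j)) ∧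
      ∀ R, D M R → ∃ j, R ⊆ U j := by
  obtain ⟨χ, hχ, hT⟩ := hasTransversal_firstOrder hdc hrel hsfo
  let T := {R : Set (Fin k → M) // D M R}
  let I : Interp (SigPE k) (M ⊕ T) := fun n r =>
    match r with
    | .inl _ => {x | ∀ i, ∃ m, x i = Sum.inl m}
    | .inr h => {x | ∃ (f : Fin k → M) (U : T), f ∉ U.1 ∧
        (fun i => x (Fin.cast h.down.symm i)) = Fin.snoc (fun i => Sum.inl (f i)) (Sum.inr U)}
  have hP : ∀ z, z ∈ PSet I (symP k) ↔ ∃ m, z = Sum.inl m := fun z =>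
    ⟨fun h => h 0, fun h _ => h⟩
  have hE : ∀ x, x ∈ I _ (symE k) ↔ ∃ (f : Fin k → M) (U : T), f ∉ U.1 ∧
      x = Fin.snoc (fun i => Sum.inl (f i)) (Sum.inr U) := fun x => Iff.rfl
  have hnot : ¬ HasTransversal D (M ⊕ T) I := by
    rintro ⟨R, ⟨hRP, hR⟩, hz⟩
    let e : M ≃ PSet I (symP k) := Equiv.ofBijective (fun m => ⟨Sum.inl m, (hP _).2 ⟨m, rfl⟩⟩)
      ⟨fun m m' h => Sum.inl_injective (Subtype.ext_iff.1 h), fun ⟨z, hzP⟩ => by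
        obtain ⟨m, rfl⟩ := (hP z).1 hzP
        exact ⟨m, rfl⟩⟩
    have hR' : D M {f | (fun i => (Sum.inl (f i) : M ⊕ T)) ∈ R} :=
      (hiso.iff e fun f => Iff.rfl).2 hR
    obtain ⟨f, hf, hfE⟩ := hz (Sum.inr ⟨_, hR'⟩) fun h => by
      obtain ⟨m, hm⟩ := (hP _).1 h
      cases hm
    obtain ⟨g, U, hgU, hfg⟩ := (hE _).1 hfE
    obtain ⟨h1, h2⟩ := (Fin.snoc_inj).1 hfg
    obtain rfl := Sum.inr_injective h2
    exact hgU (by rw [h1] at hf; exact hf)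
  obtain ⟨N, hMN, hNc, hNi, hN⟩ := exists_countable_elementary I (Set.range Sum.inl)
    (Set.countable_range _)
  have : Countable N := hNc
  have : Infinite N := hNi.to_subtype
  have hnotN : ¬ HasTransversal D N (I.restrict N) := by
    rw [hT N inferInstance, hχ.foTrue_iff _ (fun _ => Classical.arbitrary N), hN,
      ← hχ.foTrue_iff I, ← hT _ inferInstance]
    exact hnot
  have hPN : ∀ z : N, z ∈ PSet (I.restrict N) (symP k) ↔ ∃ m, (z : M ⊕ T) = Sum.inl m :=
    fun z => hP z
  refine ⟨{U : T // Sum.inr U ∈ N}, fun U => U.1.1, ?_, fun U => U.1.2, fun R hR => ?_⟩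
  · refine Function.Injective.countable (f := fun U => (⟨Sum.inr U.1, U.2⟩ : N)) ?_
    intro U V h
    exact Subtype.ext (Sum.inr_injective (Subtype.ext_iff.1 h))
  · by_contra! hcov
    refine hnotN ⟨{x | ∃ f ∈ R, ∀ i, (x i : M ⊕ T) = Sum.inl (f i)}, ⟨?_, ?_⟩, fun z hz => ?_⟩
    · rintro x ⟨f, -, hf⟩ i
      exact (hPN _).2 ⟨_, hf i⟩
    · let e : M ≃ PSet (I.restrict N) (symP k) := Equiv.ofBijective
        (fun m => ⟨⟨Sum.inl m, hMN ⟨m, rfl⟩⟩, (hPN _).2 ⟨m, rfl⟩⟩)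
        ⟨fun m m' h => Sum.inl_injective (Subtype.ext_iff.1 (Subtype.ext_iff.1 h)),
          fun ⟨z, hzP⟩ => by
            obtain ⟨m, hm⟩ := (hPN z).1 hzP
            exact ⟨m, Subtype.ext (Subtype.ext hm.symm)⟩⟩
      refine (hiso.iff e fun f => ?_).1 hR
      constructor
      · exact fun hf => ⟨f, hf, fun _ => rfl⟩
      · rintro ⟨g, hg, hgf⟩
        rwa [show f = g from funext fun i => Sum.inl_injective (hgf i)]
    · obtain ⟨z, hzN⟩ := z
      rcases z with m | U
      · exact absurd ((hPN _).2 ⟨m, rfl⟩) hz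
      · obtain ⟨f, hf, hfU⟩ := Set.not_subset.1 (hcov ⟨U, hzN⟩)
        refine ⟨fun i => ⟨Sum.inl (f i), hMN ⟨_, rfl⟩⟩, ⟨f, hf, fun _ => rfl⟩, ?_⟩
        change (fun _ => Subtype.val _) ∈ I _ (symE k)
        refine (hE _).2 ⟨f, U, hfU, ?_⟩
        funext i
        refine Fin.lastCases ?_ (fun i => ?_) i
        · simp
        · simp

end SingleDependency

section FiniteSupport

variable {S : Signature} {k : ℕ} {D : DepPred k}

theorem dfn₂_pattern {n : ℕ} (v : Fin k → ℕ) (Θ : Set (Pattern k n)) :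
    Dfn₂ (S := S) fun _ _ s a => pattern (fun i => s (v i)) (fun i : Fin n => a i) ∈ Θ := by
  let t : Fin k ⊕ Fin n → ℕ := Sum.elim (fun i => 2 * v i) fun j => 2 * j + 1
  refine (dfn_exists (C := Pattern k n) fun e => (dfn_const (e ∈ Θ)).and
    (dfn_forall fun p => dfn_forall fun q => (dfn_const (e p q)).iff
      (dfn_eq (t p) (t q)))).congr fun M _ _ w => ?_
  have ht : ∀ p, Sum.elim (fun i => w (2 * v i)) (fun i : Fin n => w (2 * i + 1)) p = w (t p) := by
    rintro (i | j) <;> rfl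
  have hp : pattern (fun i => w (2 * v i)) (fun i : Fin n => w (2 * i + 1)) =
      fun p q => w (t p) = w (t q) := by
    funext p q
    simp only [pattern, ht]
  beta_reduce
  rw [hp]
  constructor
  · rintro ⟨e, he, h⟩
    convert he using 1
    funext p q
    exact propext (h p q).symm
  · exact fun h => ⟨_, h, fun p q => Iff.rfl⟩

theorem FirstOrderDep.dfn₂_patternSet (hD : FirstOrderDep D) {n : ℕ} (Θ : Set (Pattern k n)) :
    Dfn₂ (S := S) fun M _ _ a => D M (patternSet Θ fun i : Fin n => a i) := by
  obtain ⟨ψ, hψ, h⟩ := hD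
  refine Dfn.congr (dfn₂_fsat_interpR ψ
    (T := fun M _ f a => pattern f (fun i : Fin n => a i) ∈ Θ)
    fun v => dfn₂_pattern v Θ) fun M hM _ w => ?_
  beta_reduce
  rw [h M hM, hψ.foTrue_iff _ fun v => w (2 * v)]
  rfl

/-- The relation named by the symbol of `SigR k`. -/
def Interp.relation {M : Type} (I : Interp (SigR k) M) : Set (Fin k → M) := I k ⟨rfl⟩

theorem interpR_relation {M : Type} (I : Interp (SigR k) M) : interpR I.relation = I := by
  funext _ r
  obtain ⟨rfl⟩ := r
  rfl

theorem FirstOrderDep.dfn_relation (hD : FirstOrderDep D) :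
    Dfn (S := SigR k) fun M I _ => D M I.relation := by
  obtain ⟨ψ, hψ, h⟩ := hD
  refine (dfn_fsat ψ).congr fun M hM I s => ?_
  rw [h M hM, interpR_relation, hψ.foTrue_iff I s]

/-- `R` is contained in a relation in `D` that is defined by equality patterns over `n`
parameters. -/
def HasSupport (D : DepPred k) (n : ℕ) (M : Type) (R : Set (Fin k → M)) : Prop :=
  ∃ (Θ : Set (Pattern k n)) (a : Fin n → M), R ⊆ patternSet Θ a ∧ D M (patternSet Θ a)

theorem HasSupport.mono {M : Type} [Nonempty M] {R : Set (Fin k → M)} {n m : ℕ}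
    (h : HasSupport D n M R) (hnm : n ≤ m) : HasSupport D m M R := by
  obtain ⟨Θ, a, hR, hD⟩ := h
  let g : Fin k ⊕ Fin n → Fin k ⊕ Fin m := Sum.map id (Fin.castLE hnm)
  let a' : Fin m → M := Function.extend (Fin.castLE hnm) a fun _ => Classical.arbitrary M
  have hg : ∀ (f : Fin k → M) p, Sum.elim f a' (g p) = Sum.elim f a p := by
    rintro f (i | j)
    · rfl
    · exact (Fin.castLE_injective hnm).extend_apply a (fun _ => Classical.arbitrary M) j
  have : patternSet {e | (fun p q => e (g p) (g q)) ∈ Θ} a' = patternSet Θ a := by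
    ext f
    simp only [patternSet, pattern, Set.mem_ofPred_eq, hg]
    rfl
  exact ⟨_, a', this ▸ hR, this ▸ hD⟩

theorem exists_extension {M : Type} [Nonempty M] {n : ℕ} (f : Fin n → M) :
    ∃ s : ℕ → M, (fun i : Fin n => s i) = f :=
  ⟨Function.extend Fin.val f fun _ => Classical.arbitrary M,
    funext (Fin.val_injective.extend_apply f _)⟩

theorem FirstOrderDep.dfn_hasSupport (hD : FirstOrderDep D) (n : ℕ) :
    Dfn (S := SigR k) fun M I _ => HasSupport D n M I.relation := by
  refine (dfn_exists fun Θ : Set (Pattern k n) => Dfn₂.exists_forall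
    (P := fun M I s a => ((fun i : Fin k => s i) ∈ I.relation →
      pattern (fun i : Fin k => s i) (fun i : Fin n => a i) ∈ Θ) ∧
        D M (patternSet Θ fun i : Fin n => a i)) ?_).congr fun M _ I _ => ?_
  · exact Dfn.and (Dfn.imp (dfn_rel (S := SigR k) ⟨rfl⟩ fun i => 2 * i)
      (dfn₂_pattern (fun i => i) Θ)) (hD.dfn₂_patternSet Θ)
  · refine exists_congr fun Θ => ⟨?_, ?_⟩
    · rintro ⟨a, ha⟩
      refine ⟨fun i => a i, fun f hf => ?_, (ha a).2⟩
      obtain ⟨s, rfl⟩ := exists_extension f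
      exact (ha s).1 hf
    · rintro ⟨a, hR, ha⟩
      obtain ⟨a, rfl⟩ := exists_extension a
      exact ⟨a, fun s => ⟨fun hs => hR hs, ha⟩⟩

theorem Dfn.exists_sentence {P : ∀ M : Type, Interp S M → Prop} (h : Dfn fun M I _ => P M I) :
    ∃ ψ : FOF S, IsSentence ψ ∧
      ∀ M : Type, Nontrivial M → ∀ I : Interp S M, FOTrue M I ψ ↔ P M I := by
  obtain ⟨χ, hχ⟩ := h
  obtain ⟨ψ, hψ, hψχ⟩ := DSFO.exists_sentence χ
  refine ⟨ψ, hψ, fun M hM I => (hψχ M I).trans ?_⟩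
  simp only [FOTrue, hχ M hM, forall_const]

theorem hasSupport_of_finite {M : Type} [Finite M] {R : Set (Fin k → M)} (hR : D M R) :
    ∃ n, HasSupport D n M R := by
  obtain ⟨n, ⟨e⟩⟩ := Finite.exists_equiv_fin M
  have h : patternSet {p | ∃ f ∈ R, pattern f e.symm = p} e.symm = R := by
    refine Set.Subset.antisymm ?_ fun f hf => ⟨f, hf, rfl⟩
    rintro g ⟨f, hf, hfg⟩
    suffices f = g from this ▸ hf
    funext i
    have := congrFun (congrFun hfg (Sum.inl i)) (Sum.inr (e (f i)))
    simp only [pattern, Sum.elim_inl, Sum.elim_inr, Equiv.symm_apply_apply, eq_iff_iff,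
      true_iff] at this
    exact this.symm
  exact ⟨n, _, e.symm, h.ge, h.symm ▸ hR⟩

instance (k n : ℕ) : Countable (SigR k n) := inferInstanceAs (Countable (PLift (n = k)))

/-- The relations of a relativizable, strongly first order, downwards closed dependency are
uniformly supported by a fixed number of parameters. -/
theorem exists_hasSupport (hiso : IsoClosed D) (hdc : DownwardsClosed D)
    (hrel : Relativizable1 D) (hsfo : SFOd D) :
    ∃ n, ∀ M : Type, Nontrivial M → ∀ R, D M R → HasSupport D n M R := by
  by_contra! hno
  choose M hM R hR hn using hno
  have hfo := hsfo.firstOrderDep hdc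
  obtain ⟨N, J, hne, hJ⟩ := exists_limit_model M fun n => interpR (R n)
  have hN : Nontrivial N := by
    have := hJ (.ex 0 (.ex 1 (.neq 0 1))) (by simp [IsSentence, fv]) ⟨0, fun n _ s => by
      obtain ⟨x, y, hxy⟩ := exists_pair_ne (M n)
      exact ⟨x, y, by simpa [FSat] using hxy⟩⟩
    obtain ⟨x, y, hxy⟩ := this fun _ => Classical.arbitrary N
    exact ⟨x, y, by simpa [FSat] using hxy⟩
  obtain ⟨ψ, hψ, hψD⟩ := hfo.dfn_relation.exists_sentence
  have hDN : FOTrue N J ψ := hJ ψ hψ ⟨0, fun n _ => (hψD _ (hM n) _).2 (hR n)⟩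
  choose η hη hηD using fun n => (hfo.dfn_hasSupport n).not.exists_sentence
  have hηN : ∀ m, FOTrue N J (η m) := fun m => hJ _ (hη m) ⟨m, fun n hmn =>
    (hηD m _ (hM n) _).2 fun h => hn n (h.mono hmn)⟩
  rcases finite_or_infinite N with hfin | hinf
  · obtain ⟨n, h⟩ := hasSupport_of_finite ((hψD N hN J).1 hDN)
    exact (hηD n N hN J).1 (hηN n) h
  · obtain ⟨N', -, hc, hi, hN'⟩ := exists_countable_elementary J ∅ Set.countable_empty
    have : Countable N' := hc
    have : Infinite N' := hi.to_subtype
    have hsent : ∀ φ : FOF (SigR k), FOTrue N J φ → FOTrue N' (J.restrict N') φ :=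
      fun φ h s => (hN' φ s).2 (h _)
    obtain ⟨I, U, _, hU, hcov⟩ := exists_countable_cover hiso hdc hrel hsfo N'
    obtain ⟨n, h⟩ := exists_patternSet_of_countable_cover hiso hdc U hU hcov
      ((hψD N' inferInstance _).1 (hsent ψ hDN))
    exact (hηD n N' inferInstance _).1 (hsent _ (hηN n)) h

end FiniteSupport

section Elimination

variable {S : Signature} {ι : Type} {ar : ι → ℕ}

theorem Dfn₂.comp_right {P : ∀ M : Type, Interp S M → (ℕ → M) → (ℕ → M) → Prop} (h : Dfn₂ P)
    {τ : ℕ → ℕ} (hτ : Function.Injective τ) : Dfn₂ fun M I s a => P M I s (fun j => a (τ j)) := by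
  let σ : ℕ → ℕ := fun u => if u % 2 = 0 then u else 2 * τ (u / 2) + 1
  have hσ : Function.Injective σ := fun u v huv => by
    simp only [σ] at huv
    split_ifs at huv
    · exact huv
    · omega
    · omega
    · have := hτ (show τ (u / 2) = τ (v / 2) by omega)
      omega
  refine (Dfn.comp h hσ).congr fun M _ I w => ?_
  have h1 : ∀ j, σ (2 * j) = 2 * j := fun j => by simp [σ]
  have h2 : ∀ j, σ (2 * j + 1) = 2 * τ j + 1 := fun j => by
    simp [σ, show (2 * j + 1) / 2 = j by omega]
  simp only [Function.comp, h1, h2]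

theorem exists_interleaving {M : Type} (a b : ℕ → M) :
    ∃ c : ℕ → M, (fun j => c (2 * j)) = a ∧ (fun j => c (2 * j + 1)) = b :=
  ⟨fun v => if v % 2 = 0 then a (v / 2) else b (v / 2), funext fun j => by simp,
    funext fun j => by simp [show (2 * j + 1) / 2 = j by omega]⟩

/-- If all dependencies are first order and uniformly supported, then satisfaction of a formula by
a team amounts to the existence of parameters with which all assignments satisfy one of finitely
many first-order formulas. -/
theorem exists_dfn₂_tSat {D : ∀ i, DepPred (ar i)} (hdc : ∀ i, DownwardsClosed (D i))
    (hemp : ∀ i, EmptyTeamProp (D i)) (hfo : ∀ i, FirstOrderDep (D i))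
    (hsupp : ∀ i, ∃ n, ∀ M : Type, Nontrivial M → ∀ R, D i M R → HasSupport (D i) n M R)
    (φ : TS S ι ar) (hφ : Plain φ) :
    ∃ (C : Type) (_ : Finite C) (Q : C → ∀ M : Type, Interp S M → (ℕ → M) → (ℕ → M) → Prop),
      (∀ c, Dfn₂ (Q c)) ∧ ∀ M : Type, Nontrivial M → ∀ (I : Interp S M) (X : Set (ℕ → M)),
        TSat M I (fun i => D i M) φ X ↔ ∃ c a, ∀ s ∈ X, Q c M I s a := by
  have lit : ∀ P : ∀ M : Type, Interp S M → (ℕ → M) → Prop,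
      (Dfn₂ fun M I s _ => P M I s) →
      ∃ (C : Type) (_ : Finite C) (Q : C → ∀ M : Type, Interp S M → (ℕ → M) → (ℕ → M) → Prop),
      (∀ c, Dfn₂ (Q c)) ∧ ∀ M : Type, Nontrivial M → ∀ (I : Interp S M) (X : Set (ℕ → M)),
        (∀ s ∈ X, P M I s) ↔ ∃ c a, ∀ s ∈ X, Q c M I s a := fun P hP =>
    ⟨Unit, inferInstance, fun _ M I s _ => P M I s, fun _ => hP, fun M _ I X =>
      ⟨fun h => ⟨(), fun _ => Classical.arbitrary M, h⟩, fun ⟨_, _, h⟩ => h⟩⟩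
  have heven : Function.Injective fun j : ℕ => 2 * j := fun a b h => by simpa using h
  have hodd : Function.Injective fun j : ℕ => 2 * j + 1 := fun a b h => by simpa using h
  induction φ with
  | rel r v => exact lit _ (dfn_rel r fun i => 2 * v i)
  | nrel r v => exact lit _ (dfn_rel r fun i => 2 * v i).not
  | eq x y => exact lit _ (dfn_eq (2 * x) (2 * y))
  | neq x y => exact lit _ (dfn_eq (2 * x) (2 * y)).not
  | gdisj φ ψ => exact hφ.2.elim
  | cneg φ => exact hφ.1.elim
  | dep i v =>
    obtain ⟨n, hn⟩ := hsupp i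
    refine ⟨Set (Pattern (ar i) n), inferInstance, fun Θ M _ s a =>
      D i M (patternSet Θ fun j : Fin n => a j) ∧
        pattern (fun j => s (v j)) (fun j : Fin n => a j) ∈ Θ,
      fun Θ => Dfn.and ((hfo i).dfn₂_patternSet Θ) (dfn₂_pattern v Θ), fun M hM I X => ?_⟩
    constructor
    · intro h
      obtain ⟨Θ, a, hX, hD⟩ := hn M hM _ h
      obtain ⟨a, rfl⟩ := exists_extension a
      exact ⟨Θ, a, fun s hs => ⟨hD, hX ⟨s, hs, rfl⟩⟩⟩
    · rintro ⟨Θ, a, h⟩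
      rcases X.eq_empty_or_nonempty with rfl | ⟨s, hs⟩
      · change D i M (teamProj v ∅)
        rw [show teamProj v (∅ : Set (ℕ → M)) = ∅ by simp [teamProj]]
        exact hemp i M hM
      · refine hdc i M _ _ (h s hs).1 ?_
        rintro _ ⟨t, ht, rfl⟩
        exact (h t ht).2
  | and φ ψ h1 h2 =>
    obtain ⟨C₁, _, Q₁, hQ₁, h1⟩ := h1 ⟨hφ.1.1, hφ.2.1⟩
    obtain ⟨C₂, _, Q₂, hQ₂, h2⟩ := h2 ⟨hφ.1.2, hφ.2.2⟩
    refine ⟨C₁ × C₂, inferInstance, fun c M I s a =>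
      Q₁ c.1 M I s (fun j => a (2 * j)) ∧ Q₂ c.2 M I s fun j => a (2 * j + 1),
      fun c => Dfn.and ((hQ₁ c.1).comp_right heven) ((hQ₂ c.2).comp_right hodd),
      fun M hM I X => ?_⟩
    simp only [TSat, h1 M hM, h2 M hM]
    constructor
    · rintro ⟨⟨c, a, hc⟩, d, b, hd⟩
      obtain ⟨e, rfl, rfl⟩ := exists_interleaving a b
      exact ⟨(c, d), e, fun s hs => ⟨hc s hs, hd s hs⟩⟩
    · rintro ⟨c, a, h⟩
      exact ⟨⟨c.1, _, fun s hs => (h s hs).1⟩, c.2, _, fun s hs => (h s hs).2⟩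
  | or φ ψ h1 h2 =>
    obtain ⟨C₁, _, Q₁, hQ₁, h1⟩ := h1 ⟨hφ.1.1, hφ.2.1⟩
    obtain ⟨C₂, _, Q₂, hQ₂, h2⟩ := h2 ⟨hφ.1.2, hφ.2.2⟩
    refine ⟨C₁ × C₂, inferInstance, fun c M I s a =>
      Q₁ c.1 M I s (fun j => a (2 * j)) ∨ Q₂ c.2 M I s fun j => a (2 * j + 1),
      fun c => Dfn.or ((hQ₁ c.1).comp_right heven) ((hQ₂ c.2).comp_right hodd),
      fun M hM I X => ?_⟩
    simp only [TSat, h1 M hM, h2 M hM]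
    constructor
    · rintro ⟨Y, Z, rfl, ⟨c, a, hc⟩, d, b, hd⟩
      obtain ⟨e, rfl, rfl⟩ := exists_interleaving a b
      exact ⟨(c, d), e, fun s hs => hs.imp (hc s) (hd s)⟩
    · rintro ⟨c, a, h⟩
      refine ⟨{s ∈ X | Q₁ c.1 M I s fun j => a (2 * j)},
        {s ∈ X | Q₂ c.2 M I s fun j => a (2 * j + 1)}, ?_,
        ⟨c.1, _, fun s hs => hs.2⟩, c.2, _, fun s hs => hs.2⟩
      ext s
      exact ⟨fun hs => hs.elim (·.1) (·.1), fun hs => (h s hs).imp (⟨hs, ·⟩) (⟨hs, ·⟩)⟩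
  | ex v φ ih =>
    obtain ⟨C, hC, Q, hQ, ih⟩ := ih hφ
    refine ⟨C, hC, fun c M I s a => ∃ m, Q c M I (Function.update s v m) a,
      fun c => (Dfn.ex (2 * v) (hQ c)).congr fun M _ I w => ?_, fun M hM I X => ?_⟩
    · simp only [update_even, update_even_odd]
    simp only [TSat, ih M hM]
    constructor
    · rintro ⟨H, hH, c, a, h⟩
      exact ⟨c, a, fun s hs => (hH s hs).imp fun m hm => h _ ⟨s, hs, m, hm, rfl⟩⟩
    · rintro ⟨c, a, h⟩
      refine ⟨fun s => {m | Q c M I (Function.update s v m) a}, h, c, a, ?_⟩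
      rintro _ ⟨s, hs, m, hm, rfl⟩
      exact hm
  | al v φ ih =>
    obtain ⟨C, hC, Q, hQ, ih⟩ := ih hφ
    refine ⟨C, hC, fun c M I s a => ∀ m, Q c M I (Function.update s v m) a,
      fun c => (Dfn.al (2 * v) (hQ c)).congr fun M _ I w => ?_, fun M hM I X => ?_⟩
    · simp only [update_even, update_even_odd]
    simp only [TSat, ih M hM]
    constructor
    · rintro ⟨c, a, h⟩
      exact ⟨c, a, fun s hs m => h _ ⟨s, hs, m, rfl⟩⟩
    · rintro ⟨c, a, h⟩
      refine ⟨c, a, ?_⟩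
      rintro _ ⟨s, hs, m, rfl⟩
      exact h s hs m

/-- A formula with a single dependency atom as a formula with a family of atoms. -/
def TS.reindex (i : ι) : TS S Unit (fun _ => ar i) → TS S ι ar
  | .rel r v => .rel r v
  | .nrel r v => .nrel r v
  | .eq x y => .eq x y
  | .neq x y => .neq x y
  | .dep _ v => .dep i v
  | .and φ ψ => .and (TS.reindex i φ) (TS.reindex i ψ)
  | .or φ ψ => .or (TS.reindex i φ) (TS.reindex i ψ)
  | .gdisj φ ψ => .gdisj (TS.reindex i φ) (TS.reindex i ψ)
  | .cneg φ => .cneg (TS.reindex i φ)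
  | .ex v φ => .ex v (TS.reindex i φ)
  | .al v φ => .al v (TS.reindex i φ)

theorem fv_reindex (i : ι) (φ : TS S Unit fun _ => ar i) : fv (φ.reindex i) = fv φ := by
  induction φ <;> simp_all [TS.reindex, fv]

theorem plain_reindex (i : ι) (φ : TS S Unit fun _ => ar i) : Plain (φ.reindex i) ↔ Plain φ := by
  refine and_congr ?_ ?_
  · induction φ <;> simp_all [TS.reindex, NoCneg]
  · induction φ <;> simp_all [TS.reindex, NoGdisj]

theorem tSat_reindex {M : Type} (I : Interp S M) (A : ∀ i, Set (Fin (ar i) → M) → Prop) (i : ι)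
    (φ : TS S Unit fun _ => ar i) (X : Set (ℕ → M)) :
    TSat M I A (φ.reindex i) X ↔ TSat M I (fun _ => A i) φ X := by
  induction φ generalizing X <;> simp_all [TS.reindex, TSat]

theorem SFOFam.sfod {D : ∀ i, DepPred (ar i)} (h : SFOFam D) (i : ι) : SFOd (D i) := by
  intro S φ hφ hp
  obtain ⟨ψ, hψ, hφψ⟩ := h S (φ.reindex i) (by rwa [IsSentence, fv_reindex])
    ((plain_reindex i φ).2 hp)
  exact ⟨ψ, hψ, fun M hM I => (tSat_reindex I _ i φ _).symm.trans (hφψ M hM I)⟩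

end Elimination

/-- A family of downwards closed, relativizable generalized
dependencies with the empty team property is strongly first order iff every
dependency in it is strongly first order. -/
theorem family_sfo_iff_each_sfo {ι : Type} {ar : ι → ℕ} (D : ∀ i, DepPred (ar i))
    (hiso : ∀ i, IsoClosed (D i)) (hdc : ∀ i, DownwardsClosed (D i))
    (hrel : ∀ i, Relativizable1 (D i)) (hemp : ∀ i, EmptyTeamProp (D i)) :
    SFOFam D ↔ ∀ i, SFOd (D i) := by
  refine ⟨fun h => h.sfod, fun h S φ _ hp => ?_⟩
  obtain ⟨C, _, Q, hQ, hφ⟩ := exists_dfn₂_tSat hdc hemp (fun i => (h i).firstOrderDep (hdc i))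
    (fun i => exists_hasSupport (hiso i) (hdc i) (hrel i) (h i)) φ hp
  obtain ⟨ψ, hψ, hQψ⟩ := (dfn_exists fun c => (hQ c).exists_forall).exists_sentence
  refine ⟨ψ, hψ, fun M hM I => (hφ M hM I Set.univ).trans ?_⟩
  simpa using (hQψ M hM I).symm

end DSFO
end
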